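/- Let k be a field and H a commutative noetherian Hopf algebra over k with bijective antipode. Assume that the category of left-right Yetter-Drinfeld modules over H satisfies condition (†), and that the coinvariants functor M ↦ M^{coH} from the category of Yetter-Drinfeld modules to k-vector spaces is exact. Then every Yetter-Drinfeld module M is a direct sum, in the category of Yetter-Drinfeld modules, of a family of simple subobjects that are finitely generated as H-modules; in particular the category of Yetter-Drinfeld modules over H is semisimple. -/

import Mathlib

/-!
Common definitions for formalizing "Semisimplicity of the categories of
Yetter-Drinfeld modules and Long dimodules" (Caenepeel, Guédénon).
-/

open TensorProduct

noncomputable section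
namespace YDPaper

section RingPart

variable (k H : Type) [CommRing k] [Ring H] [HopfAlgebra k H]

/-- `ρ : M →ₗ[k] M ⊗[k] H` is a (coassociative, counital) right `H`-comodule
structure on `M`. -/
def IsComod {M : Type} [AddCommGroup M] [Module k M] (ρ : M →ₗ[k] M ⊗[k] H) : Prop :=
  (∀ m : M, (TensorProduct.rid k M)
      ((LinearMap.lTensor M (Coalgebra.counit (R := k) (A := H))) (ρ m)) = m) ∧
  (∀ m : M, (TensorProduct.assoc k M H H) ((LinearMap.rTensor H ρ) (ρ m)) =
      (LinearMap.lTensor M (Coalgebra.comul (R := k) (A := H))) (ρ m))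

/-- The iterated comultiplication `h ↦ (h₁ ⊗ h₂) ⊗ h₃`. -/
def Delta2 : H →ₗ[k] (H ⊗[k] H) ⊗[k] H :=
  (LinearMap.rTensor H (Coalgebra.comul (R := k) (A := H))).comp
    (Coalgebra.comul (R := k) (A := H))

/-- The Yetter-Drinfeld compatibility condition
`ρ(h • m) = h₂ • m₀ ⊗ h₃ m₁ S⁻¹(h₁)`, expressed via arbitrary Sweedler
decompositions of `Δ²(h)` and `ρ(m)` into finite sums of pure tensors. -/
def IsYDCompat (Sinv : H →ₗ[k] H) {M : Type} [AddCommGroup M] [Module k M] [Module H M]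
    (ρ : M →ₗ[k] M ⊗[k] H) : Prop :=
  ∀ (h : H) (m : M) (s t : Finset ℕ) (a b c : ℕ → H) (m₀ : ℕ → M) (m₁ : ℕ → H),
    (∑ i ∈ s, (a i ⊗ₜ[k] b i) ⊗ₜ[k] c i) = Delta2 k H h →
    (∑ j ∈ t, m₀ j ⊗ₜ[k] m₁ j) = ρ m →
    ρ (h • m) = ∑ i ∈ s, ∑ j ∈ t, (b i • m₀ j) ⊗ₜ[k] (c i * m₁ j * Sinv (a i))

/-- The `k`-linear map `m ↦ h • m`. -/
def smulMap {M : Type} [AddCommGroup M] [Module k M] [Module H M] [SMulCommClass H k M]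
    (h : H) : M →ₗ[k] M where
  toFun m := h • m
  map_add' := smul_add h
  map_smul' c m := (smul_comm h c m)

/-- The Long dimodule compatibility condition `ρ(h • m) = h • m₀ ⊗ m₁`. -/
def IsLongCompat {M : Type} [AddCommGroup M] [Module k M] [Module H M] [SMulCommClass H k M]
    (ρ : M →ₗ[k] M ⊗[k] H) : Prop :=
  ∀ (h : H) (m : M), ρ (h • m) = (LinearMap.rTensor H (smulMap k H h)) (ρ m)

/-- Morphisms in the categories of Yetter-Drinfeld modules and of Long dimodules:
`H`-linear and `H`-colinear maps. -/
def IsHom {A B : Type} [AddCommGroup A] [Module k A] [Module H A]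
    [AddCommGroup B] [Module k B] [Module H B]
    (ρA : A →ₗ[k] A ⊗[k] H) (ρB : B →ₗ[k] B ⊗[k] H) (f : A →ₗ[k] B) : Prop :=
  (∀ (h : H) (a : A), f (h • a) = h • f a) ∧
  ρB.comp f = (LinearMap.rTensor H f).comp ρA

/-- `H`-colinearity of a `k`-linear map between right `H`-comodules. -/
def IsColin {A B : Type} [AddCommGroup A] [Module k A]
    [AddCommGroup B] [Module k B]
    (ρA : A →ₗ[k] A ⊗[k] H) (ρB : B →ₗ[k] B ⊗[k] H) (f : A →ₗ[k] B) : Prop :=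
  ρB.comp f = (LinearMap.rTensor H f).comp ρA

/-- A bundled left-right Yetter-Drinfeld module over `H` (with chosen inverse `Sinv`
of the antipode). -/
structure YDCat (Sinv : H →ₗ[k] H) where
  M : Type
  [iAdd : AddCommGroup M]
  [iModk : Module k M]
  [iModH : Module H M]
  [iTower : IsScalarTower k H M]
  [iComm : SMulCommClass H k M]
  ρ : M →ₗ[k] M ⊗[k] H
  comod : IsComod k H ρ
  compat : IsYDCompat k H Sinv ρ

attribute [instance] YDCat.iAdd YDCat.iModk YDCat.iModH YDCat.iTower YDCat.iComm

/-- A bundled left-right Long dimodule over `H`. -/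
structure LongCat where
  M : Type
  [iAdd : AddCommGroup M]
  [iModk : Module k M]
  [iModH : Module H M]
  [iTower : IsScalarTower k H M]
  [iComm : SMulCommClass H k M]
  ρ : M →ₗ[k] M ⊗[k] H
  comod : IsComod k H ρ
  compat : IsLongCompat k H ρ

attribute [instance] LongCat.iAdd LongCat.iModk LongCat.iModH LongCat.iTower LongCat.iComm

/-- A bundled right `H`-comodule. -/
structure ComodCat where
  V : Type
  [iAdd : AddCommGroup V]
  [iModk : Module k V]
  ρ : V →ₗ[k] V ⊗[k] H
  comod : IsComod k H ρ

attribute [instance] ComodCat.iAdd ComodCat.iModk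

section Subobjects

variable {k H}
variable {M : Type} [AddCommGroup M] [Module k M] [Module H M] [IsScalarTower k H M]

/-- A subobject in the category of Yetter-Drinfeld modules (or Long dimodules):
an `H`-submodule which is stable under the coaction, i.e. `ρ(p) ⊆ p ⊗ H`. -/
def IsSubobject (ρ : M →ₗ[k] M ⊗[k] H) (p : Submodule H M) : Prop :=
  ∀ m ∈ p, ρ m ∈ LinearMap.range (LinearMap.rTensor H (p.restrictScalars k).subtype)

/-- A simple subobject: a nonzero coaction-stable `H`-submodule with no proper
nonzero coaction-stable `H`-submodules. -/
def IsSimpleSubobject (ρ : M →ₗ[k] M ⊗[k] H) (p : Submodule H M) : Prop :=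
  IsSubobject ρ p ∧ p ≠ ⊥ ∧
    ∀ q : Submodule H M, IsSubobject ρ q → q ≤ p → q = ⊥ ∨ q = p

/-- `M` is the (internal) direct sum of a family of simple subobjects which are
finitely generated as `H`-modules. -/
def IsSemisimpleObj (ρ : M →ₗ[k] M ⊗[k] H) : Prop :=
  ∃ (ι : Type) (S : ι → Submodule H M),
    (∀ i, IsSimpleSubobject ρ (S i) ∧ (S i).FG) ∧
    iSupIndep S ∧ (⨆ i, S i) = ⊤

end Subobjects

section Subcomodules

variable {k H}
variable {V : Type} [AddCommGroup V] [Module k V]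

/-- A subcomodule: a `k`-submodule stable under the coaction. -/
def IsSubcomod (ρ : V →ₗ[k] V ⊗[k] H) (p : Submodule k V) : Prop :=
  ∀ v ∈ p, ρ v ∈ LinearMap.range (LinearMap.rTensor H p.subtype)

/-- A simple subcomodule. -/
def IsSimpleSubcomod (ρ : V →ₗ[k] V ⊗[k] H) (p : Submodule k V) : Prop :=
  IsSubcomod ρ p ∧ p ≠ ⊥ ∧
    ∀ q : Submodule k V, IsSubcomod ρ q → q ≤ p → q = ⊥ ∨ q = p

/-- A comodule is semisimple if it is the internal direct sum of a family of simple
subcomodules. -/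
def IsSemisimpleComod (ρ : V →ₗ[k] V ⊗[k] H) : Prop :=
  ∃ (ι : Type) (S : ι → Submodule k V),
    (∀ i, IsSimpleSubcomod ρ (S i)) ∧ iSupIndep S ∧ (⨆ i, S i) = ⊤

end Subcomodules

/-- `H` is cosemisimple: every right `H`-comodule is a direct sum of simple
subcomodules. -/
def Cosemisimple : Prop := ∀ C : ComodCat k H, IsSemisimpleComod C.ρ

section Coinv

variable {k H}
variable {A B : Type} [AddCommGroup A] [Module k A] [AddCommGroup B] [Module k B]

/-- The coinvariants `M^{co H} = { m | ρ m = m ⊗ 1 }` of a right `H`-comodule. -/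
def coinv (ρ : A →ₗ[k] A ⊗[k] H) : Submodule k A :=
  LinearMap.ker (ρ - (TensorProduct.mk k A H).flip 1)

lemma mem_coinv {ρ : A →ₗ[k] A ⊗[k] H} {a : A} :
    a ∈ coinv ρ ↔ ρ a = a ⊗ₜ[k] (1 : H) := by
  simp [coinv, LinearMap.mem_ker, sub_eq_zero]

/-- The map induced on coinvariants by an `H`-colinear map. -/
def coinvMap {ρA : A →ₗ[k] A ⊗[k] H} {ρB : B →ₗ[k] B ⊗[k] H} (f : A →ₗ[k] B)
    (hf : IsColin k H ρA ρB f) : ↥(coinv ρA) →ₗ[k] ↥(coinv ρB) :=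
  f.restrict (fun a ha => by
    have h1 : ρA a = a ⊗ₜ[k] (1 : H) := mem_coinv.1 ha
    have h2 : ρB (f a) = (LinearMap.rTensor H f) (ρA a) := by
      have := congrArg (fun (g : A →ₗ[k] B ⊗[k] H) => g a) hf
      simpa using this
    rw [mem_coinv, h2, h1, LinearMap.rTensor_tmul])

end Coinv

/-- Exactness of the coinvariants functor on the category of Yetter-Drinfeld
modules. -/
def CoinvExactYD (Sinv : H →ₗ[k] H) : Prop :=
  ∀ (A B C : YDCat k H Sinv) (f : A.M →ₗ[k] B.M) (g : B.M →ₗ[k] C.M)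
    (hf : IsHom k H A.ρ B.ρ f) (hg : IsHom k H B.ρ C.ρ g),
    Function.Injective f → Function.Surjective g →
    LinearMap.range f = LinearMap.ker g →
    Function.Injective (coinvMap f hf.2) ∧
    LinearMap.range (coinvMap f hf.2) = LinearMap.ker (coinvMap g hg.2) ∧
    Function.Surjective (coinvMap g hg.2)

/-- Exactness of the coinvariants functor on the category of right `H`-comodules. -/
def CoinvExactComod : Prop :=
  ∀ (A B C : ComodCat k H) (f : A.V →ₗ[k] B.V) (g : B.V →ₗ[k] C.V)
    (hf : IsColin k H A.ρ B.ρ f) (hg : IsColin k H B.ρ C.ρ g),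
    Function.Injective f → Function.Surjective g →
    LinearMap.range f = LinearMap.ker g →
    Function.Injective (coinvMap f hf) ∧
    LinearMap.range (coinvMap f hf) = LinearMap.ker (coinvMap g hg) ∧
    Function.Surjective (coinvMap g hg)

section Eval

variable {k H}
variable {M N : Type} [AddCommGroup M] [Module k M] [Module H M]
  [IsScalarTower k H M] [SMulCommClass H k M]
  [AddCommGroup N] [Module k N] [Module H N] [IsScalarTower k H N] [SMulCommClass H k N]

/-- Evaluation at `m` of `H`-linear maps, as a `k`-linear map. -/
def evalAtH (m : M) : (M →ₗ[H] N) →ₗ[k] N where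
  toFun f := f m
  map_add' _ _ := rfl
  map_smul' _ _ := rfl

/-- Evaluation at `m` of `k`-linear maps, as a `k`-linear map. -/
def evalAtK {V : Type} [AddCommGroup V] [Module k V] (v : V) :
    (V →ₗ[k] N) →ₗ[k] N where
  toFun f := f v
  map_add' _ _ := rfl
  map_smul' _ _ := rfl

/-- Contraction `N ⊗ H → N` along a functional `φ : H → k`. -/
def contract (φ : H →ₗ[k] k) : N ⊗[k] H →ₗ[k] N :=
  (TensorProduct.rid k N).toLinearMap.comp (LinearMap.lTensor N φ)

/-- Post-composition with an `H`-linear map, as a `k`-linear map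
`Hom_H(X, M) → Hom_H(X, N)`; here `X` is the (implicit) source. -/
def postcompH {X : Type} [AddCommGroup X] [Module k X] [Module H X]
    [IsScalarTower k H X] [SMulCommClass H k X]
    (f : M →ₗ[k] N) (hf : ∀ (h : H) (m : M), f (h • m) = h • f m) :
    (X →ₗ[H] M) →ₗ[k] (X →ₗ[H] N) where
  toFun φ :=
    { toFun := fun x => f (φ x)
      map_add' := fun x y => by simp
      map_smul' := fun h x => by simp [hf] }
  map_add' φ ψ := by ext x; simp
  map_smul' c φ := by ext x; simp

end Eval

/-- Condition (†) for the category of Yetter-Drinfeld modules: for every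
Yetter-Drinfeld module `X` which is finitely generated as a left `H`-module,
the functor `Hom_H(X, -)` is exact on the category of Yetter-Drinfeld modules. -/
def DaggerYD (Sinv : H →ₗ[k] H) : Prop :=
  ∀ X : YDCat k H Sinv, Module.Finite H X.M →
  ∀ (A B C : YDCat k H Sinv) (f : A.M →ₗ[k] B.M) (g : B.M →ₗ[k] C.M)
    (hf : IsHom k H A.ρ B.ρ f) (hg : IsHom k H B.ρ C.ρ g),
    Function.Injective f → Function.Surjective g →
    LinearMap.range f = LinearMap.ker g →
    Function.Injective (postcompH (X := X.M) f hf.1) ∧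
    LinearMap.range (postcompH (X := X.M) f hf.1) =
      LinearMap.ker (postcompH (X := X.M) g hg.1) ∧
    Function.Surjective (postcompH (X := X.M) g hg.1)

/-- Condition (†) for the category of Long dimodules. -/
def DaggerLong : Prop :=
  ∀ X : LongCat k H, Module.Finite H X.M →
  ∀ (A B C : LongCat k H) (f : A.M →ₗ[k] B.M) (g : B.M →ₗ[k] C.M)
    (hf : IsHom k H A.ρ B.ρ f) (hg : IsHom k H B.ρ C.ρ g),
    Function.Injective f → Function.Surjective g →
    LinearMap.range f = LinearMap.ker g →
    Function.Injective (postcompH (X := X.M) f hf.1) ∧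
    LinearMap.range (postcompH (X := X.M) f hf.1) =
      LinearMap.ker (postcompH (X := X.M) g hg.1) ∧
    Function.Surjective (postcompH (X := X.M) g hg.1)

/-- Projective object in the category of Yetter-Drinfeld modules. -/
def IsProjectiveYD (Sinv : H →ₗ[k] H) (P : YDCat k H Sinv) : Prop :=
  ∀ (A B : YDCat k H Sinv) (g : A.M →ₗ[k] B.M) (f : P.M →ₗ[k] B.M),
    IsHom k H A.ρ B.ρ g → Function.Surjective g → IsHom k H P.ρ B.ρ f →
    ∃ l : P.M →ₗ[k] A.M, IsHom k H P.ρ A.ρ l ∧ g.comp l = f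

/-- Projective object in the category of Long dimodules. -/
def IsProjectiveLong (P : LongCat k H) : Prop :=
  ∀ (A B : LongCat k H) (g : A.M →ₗ[k] B.M) (f : P.M →ₗ[k] B.M),
    IsHom k H A.ρ B.ρ g → Function.Surjective g → IsHom k H P.ρ B.ρ f →
    ∃ l : P.M →ₗ[k] A.M, IsHom k H P.ρ A.ρ l ∧ g.comp l = f

/-- Injective object in the category of Yetter-Drinfeld modules. -/
def IsInjectiveYD (Sinv : H →ₗ[k] H) (I : YDCat k H Sinv) : Prop :=
  ∀ (A B : YDCat k H Sinv) (ι : A.M →ₗ[k] B.M) (f : A.M →ₗ[k] I.M),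
    IsHom k H A.ρ B.ρ ι → Function.Injective ι → IsHom k H A.ρ I.ρ f →
    ∃ g : B.M →ₗ[k] I.M, IsHom k H B.ρ I.ρ g ∧ g.comp ι = f

/-- Projective object in the category of right `H`-comodules. -/
def IsProjectiveComod (P : ComodCat k H) : Prop :=
  ∀ (A B : ComodCat k H) (g : A.V →ₗ[k] B.V) (f : P.V →ₗ[k] B.V),
    IsColin k H A.ρ B.ρ g → Function.Surjective g → IsColin k H P.ρ B.ρ f →
    ∃ l : P.V →ₗ[k] A.V, IsColin k H P.ρ A.ρ l ∧ g.comp l = f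

section HomLemmas

variable {k H}
variable {A B C : Type} [AddCommGroup A] [Module k A] [Module H A]
  [AddCommGroup B] [Module k B] [Module H B]
  [AddCommGroup C] [Module k C] [Module H C]

lemma IsHom.comp' {ρA : A →ₗ[k] A ⊗[k] H} {ρB : B →ₗ[k] B ⊗[k] H} {ρC : C →ₗ[k] C ⊗[k] H}
    {f : A →ₗ[k] B} {g : B →ₗ[k] C}
    (hf : IsHom k H ρA ρB f) (hg : IsHom k H ρB ρC g) :
    IsHom k H ρA ρC (g.comp f) := by
  refine ⟨fun h a => by simp [LinearMap.comp_apply, hf.1, hg.1], ?_⟩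
  calc ρC.comp (g.comp f) = (ρC.comp g).comp f := by rw [LinearMap.comp_assoc]
    _ = ((LinearMap.rTensor H g).comp ρB).comp f := by rw [hg.2]
    _ = (LinearMap.rTensor H g).comp (ρB.comp f) := by rw [LinearMap.comp_assoc]
    _ = (LinearMap.rTensor H g).comp ((LinearMap.rTensor H f).comp ρA) := by rw [hf.2]
    _ = ((LinearMap.rTensor H g).comp (LinearMap.rTensor H f)).comp ρA := by
          rw [LinearMap.comp_assoc]
    _ = (LinearMap.rTensor H (g.comp f)).comp ρA := by rw [LinearMap.rTensor_comp]

end HomLemmas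

section HomYD

variable {k H}
variable (Sinv : H →ₗ[k] H)

/-- The `k`-module of morphisms of Yetter-Drinfeld modules `Hom_H^H(A, B)`, as a
submodule of the `k`-linear maps. -/
def homYD (A B : YDCat k H Sinv) : Submodule k (A.M →ₗ[k] B.M) where
  carrier := {f | IsHom k H A.ρ B.ρ f}
  add_mem' := by
    rintro f g ⟨hf1, hf2⟩ ⟨hg1, hg2⟩
    refine ⟨fun h a => by simp [hf1, hg1, smul_add], ?_⟩
    rw [LinearMap.comp_add, LinearMap.rTensor_add, LinearMap.add_comp, hf2, hg2]
  zero_mem' := by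
    refine ⟨fun h a => by simp, ?_⟩
    rw [LinearMap.comp_zero, LinearMap.rTensor_zero, LinearMap.zero_comp]
  smul_mem' := by
    rintro c f ⟨hf1, hf2⟩
    refine ⟨fun h a => by
      rw [LinearMap.smul_apply, LinearMap.smul_apply, hf1, smul_comm], ?_⟩
    rw [LinearMap.comp_smul, LinearMap.rTensor_smul, LinearMap.smul_comp, hf2]

/-- Post-composition with a morphism of Yetter-Drinfeld modules, as a `k`-linear map
between morphism spaces. -/
def postcompYD {X B C : YDCat k H Sinv}
    (g : B.M →ₗ[k] C.M) (hg : IsHom k H B.ρ C.ρ g) :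
    ↥(homYD Sinv X B) →ₗ[k] ↥(homYD Sinv X C) where
  toFun f := ⟨g.comp f.1, IsHom.comp' f.2 hg⟩
  map_add' f g' := by ext x; simp
  map_smul' c f := by ext x; simp

/-- An injective resolution `0 → X → I⁰ → I¹ → ⋯` in the category of
Yetter-Drinfeld modules. -/
structure IsInjRes (X : YDCat k H Sinv) (I : ℕ → YDCat k H Sinv)
    (ε : X.M →ₗ[k] (I 0).M) (d : ∀ n, (I n).M →ₗ[k] (I (n + 1)).M) : Prop where
  eps_hom : IsHom k H X.ρ (I 0).ρ ε
  d_hom : ∀ n, IsHom k H (I n).ρ (I (n + 1)).ρ (d n)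
  inj : ∀ n, IsInjectiveYD k H Sinv (I n)
  mono : Function.Injective ε
  exact0 : LinearMap.range ε = LinearMap.ker (d 0)
  exact : ∀ n, LinearMap.range (d n) = LinearMap.ker (d (n + 1))

/-- A projective resolution `⋯ → P₁ → P₀ → X → 0` in the category of
Yetter-Drinfeld modules. -/
structure IsProjRes (X : YDCat k H Sinv) (P : ℕ → YDCat k H Sinv)
    (ε : (P 0).M →ₗ[k] X.M) (d : ∀ n, (P (n + 1)).M →ₗ[k] (P n).M) : Prop where
  eps_hom : IsHom k H (P 0).ρ X.ρ ε
  d_hom : ∀ n, IsHom k H (P (n + 1)).ρ (P n).ρ (d n)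
  proj : ∀ n, IsProjectiveYD k H Sinv (P n)
  epi : Function.Surjective ε
  exact0 : LinearMap.range (d 0) = LinearMap.ker ε
  exact : ∀ n, LinearMap.range (d (n + 1)) = LinearMap.ker (d n)

/-- The projective dimension of `X` in the category of Yetter-Drinfeld modules is
at most `n`. -/
def pdimLE (X : YDCat k H Sinv) (n : ℕ) : Prop :=
  ∃ (P : ℕ → YDCat k H Sinv) (ε : (P 0).M →ₗ[k] X.M)
    (d : ∀ m, (P (m + 1)).M →ₗ[k] (P m).M),
    IsProjRes Sinv X P ε d ∧ ∀ i, n < i → Subsingleton (P i).M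

/-- The injective dimension of `X` in the category of Yetter-Drinfeld modules is
at most `n`. -/
def injdimLE (X : YDCat k H Sinv) (n : ℕ) : Prop :=
  ∃ (I : ℕ → YDCat k H Sinv) (ε : X.M →ₗ[k] (I 0).M)
    (d : ∀ m, (I m).M →ₗ[k] (I (m + 1)).M),
    IsInjRes Sinv X I ε d ∧ ∀ i, n < i → Subsingleton (I i).M

/-- The complex `Hom(X, I⁰) → Hom(X, I¹) → ⋯` of morphism spaces induced by a
cochain of Yetter-Drinfeld modules. -/
def homCx (X : YDCat k H Sinv) (I : ℕ → YDCat k H Sinv)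
    (d : ∀ n, (I n).M →ₗ[k] (I (n + 1)).M)
    (hd : ∀ n, IsHom k H (I n).ρ (I (n + 1)).ρ (d n)) (n : ℕ) :
    ↥(homYD Sinv X (I n)) →ₗ[k] ↥(homYD Sinv X (I (n + 1))) :=
  postcompYD Sinv (d n) (hd n)

/-- Coboundaries of the induced complex. -/
def boundaries (X : YDCat k H Sinv) (I : ℕ → YDCat k H Sinv)
    (d : ∀ n, (I n).M →ₗ[k] (I (n + 1)).M)
    (hd : ∀ n, IsHom k H (I n).ρ (I (n + 1)).ρ (d n)) :
    ∀ i, Submodule k ↥(homYD Sinv X (I i))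
  | 0 => ⊥
  | (i + 1) => LinearMap.range (homCx Sinv X I d hd i)

/-- The `i`-th cohomology (cocycles modulo coboundaries) of the complex
`Hom(X, I⁰) → Hom(X, I¹) → ⋯`; when `I` is an injective resolution of `Y`, this is
`Ext^i(X, Y)`, the `i`-th right derived functor of `Hom_H^H(X, -)`, in the category
of Yetter-Drinfeld modules. -/
abbrev cohomology (X : YDCat k H Sinv) (I : ℕ → YDCat k H Sinv)
    (d : ∀ n, (I n).M →ₗ[k] (I (n + 1)).M)
    (hd : ∀ n, IsHom k H (I n).ρ (I (n + 1)).ρ (d n)) (i : ℕ) : Type :=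
  ↥(Submodule.map (boundaries Sinv X I d hd i).mkQ
      (LinearMap.ker (homCx Sinv X I d hd i)))

end HomYD

section CharProps

variable {k H}
variable (Sinv : H →ₗ[k] H)

/-- Characterizing property of the coaction on `Hom_H(A, B)` for Yetter-Drinfeld
modules `A`, `B`: it is determined by `f₀(m) ⊗ f₁ = f(m₀)₀ ⊗ f(m₀)₁ S(m₁)`. -/
def HomCoactChar (A B : YDCat k H Sinv)
    (ρQ : (A.M →ₗ[H] B.M) →ₗ[k] (A.M →ₗ[H] B.M) ⊗[k] H) : Prop :=
  ∀ (f : A.M →ₗ[H] B.M) (m : A.M) (t : Finset ℕ) (m₀ : ℕ → A.M) (m₁ : ℕ → H),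
    (∑ j ∈ t, m₀ j ⊗ₜ[k] m₁ j) = A.ρ m →
    (LinearMap.rTensor H (evalAtH (N := B.M) m)) (ρQ f) =
      ∑ j ∈ t, (LinearMap.lTensor B.M
          (LinearMap.mulRight k (HopfAlgebra.antipode (R := k) (A := H) (m₁ j))))
        (B.ρ (f (m₀ j)))

/-- Characterizing property of the coaction on `Hom_k(V, B)` for a comodule `V` and
a Yetter-Drinfeld module `B`: `g₀(v) ⊗ g₁ = g(v₀)₀ ⊗ g(v₀)₁ S(v₁)`. -/
def HomKCoactChar (V : ComodCat k H) (B : YDCat k H Sinv)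
    (ρ' : (V.V →ₗ[k] B.M) →ₗ[k] (V.V →ₗ[k] B.M) ⊗[k] H) : Prop :=
  ∀ (g : V.V →ₗ[k] B.M) (v : V.V) (t : Finset ℕ) (v₀ : ℕ → V.V) (v₁ : ℕ → H),
    (∑ j ∈ t, v₀ j ⊗ₜ[k] v₁ j) = V.ρ v →
    (LinearMap.rTensor H (evalAtK (N := B.M) v)) (ρ' g) =
      ∑ j ∈ t, (LinearMap.lTensor B.M
          (LinearMap.mulRight k (HopfAlgebra.antipode (R := k) (A := H) (v₁ j))))
        (B.ρ (g (v₀ j)))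

/-- Characterizing property of the Yetter-Drinfeld coaction on `H ⊗ V`:
`ρ(h ⊗ v) = h₂ ⊗ v₀ ⊗ h₃ v₁ S⁻¹(h₁)`. -/
def HTensorYDChar (V : ComodCat k H)
    (ρT : (H ⊗[k] V.V) →ₗ[k] (H ⊗[k] V.V) ⊗[k] H) : Prop :=
  ∀ (h : H) (v : V.V) (s t : Finset ℕ) (a b c : ℕ → H) (v₀ : ℕ → V.V) (v₁ : ℕ → H),
    (∑ i ∈ s, (a i ⊗ₜ[k] b i) ⊗ₜ[k] c i) = Delta2 k H h →
    (∑ j ∈ t, v₀ j ⊗ₜ[k] v₁ j) = V.ρ v →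
    ρT (h ⊗ₜ[k] v) =
      ∑ i ∈ s, ∑ j ∈ t, (b i ⊗ₜ[k] v₀ j) ⊗ₜ[k] (c i * v₁ j * Sinv (a i))

/-- Characterizing property of the Long dimodule coaction on `H ⊗ V`:
`ρ(h ⊗ v) = h ⊗ v₀ ⊗ v₁`. -/
def HTensorLongChar (V : ComodCat k H)
    (ρT : (H ⊗[k] V.V) →ₗ[k] (H ⊗[k] V.V) ⊗[k] H) : Prop :=
  ∀ (h : H) (v : V.V) (t : Finset ℕ) (v₀ : ℕ → V.V) (v₁ : ℕ → H),
    (∑ j ∈ t, v₀ j ⊗ₜ[k] v₁ j) = V.ρ v →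
    ρT (h ⊗ₜ[k] v) = ∑ j ∈ t, (h ⊗ₜ[k] v₀ j) ⊗ₜ[k] v₁ j

end CharProps

end RingPart

section CommPart

variable {k H : Type} [CommRing k] [CommRing H] [HopfAlgebra k H] (Sinv : H →ₗ[k] H)

/-- Characterizing property of the Yetter-Drinfeld coaction on `M ⊗_H N`:
`ρ(m ⊗ n) = m₀ ⊗ n₀ ⊗ n₁ m₁` (for `H` commutative). -/
def TensorCoactChar (A B : YDCat k H Sinv)
    (ρT : (A.M ⊗[H] B.M) →ₗ[k] (A.M ⊗[H] B.M) ⊗[k] H) : Prop :=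
  ∀ (m : A.M) (n : B.M) (s t : Finset ℕ) (m₀ : ℕ → A.M) (m₁ : ℕ → H)
    (n₀ : ℕ → B.M) (n₁ : ℕ → H),
    (∑ i ∈ s, m₀ i ⊗ₜ[k] m₁ i) = A.ρ m →
    (∑ j ∈ t, n₀ j ⊗ₜ[k] n₁ j) = B.ρ n →
    ρT (m ⊗ₜ[H] n) =
      ∑ i ∈ s, ∑ j ∈ t, (m₀ i ⊗ₜ[H] n₀ j) ⊗ₜ[k] (n₁ j * m₁ i)

/-- Restriction along `v ↦ 1 ⊗ v`, i.e. the canonical map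
`Hom_H(H ⊗ V, N) → Hom_k(V, N)`, `f ↦ (v ↦ f(1 ⊗ v))`. -/
def resUnitMap (V : Type) [AddCommGroup V] [Module k V] (N : Type) [AddCommGroup N]
    [Module k N] [Module H N] [IsScalarTower k H N] [SMulCommClass H k N] :
    ((H ⊗[k] V) →ₗ[H] N) →ₗ[k] (V →ₗ[k] N) where
  toFun f := (f.restrictScalars k).comp ((TensorProduct.mk k H V) 1)
  map_add' f g := by ext v; rfl
  map_smul' c f := by ext v; rfl

end CommPart

section Conv

open WithConv

variable {k H : Type} [Field k] [CommRing H] [HopfAlgebra k H]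
variable {R : Type} [CommRing R] [Algebra k R] {R' : Type} [CommRing R'] [Algebra k R']

/-- Convolution of algebra maps. -/
def cm (φ ψ : H →ₐ[k] R) : H →ₐ[k] R := (toConv φ * toConv ψ).ofConv

/-- Convolution unit. -/
def c1 : H →ₐ[k] R := (1 : WithConv (H →ₐ[k] R)).ofConv

/-- Convolution inverse. -/
def ci (φ : H →ₐ[k] R) : H →ₐ[k] R := φ.comp (HopfAlgebra.antipodeAlgHom k H)

lemma cm_assoc (a b c : H →ₐ[k] R) : cm (cm a b) c = cm a (cm b c) := by
  simp only [cm, toConv_ofConv, mul_assoc]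

lemma c1_cm (a : H →ₐ[k] R) : cm c1 a = a := by
  simp only [cm, c1, toConv_ofConv, one_mul, ofConv_toConv]

lemma cm_c1 (a : H →ₐ[k] R) : cm a c1 = a := by
  simp only [cm, c1, toConv_ofConv, mul_one, ofConv_toConv]

lemma comp_cm (α : R →ₐ[k] R') (a b : H →ₐ[k] R) :
    α.comp (cm a b) = cm (α.comp a) (α.comp b) :=
  AlgHom.comp_convMul_distrib α (toConv a) (toConv b)

lemma comp_c1 (α : R →ₐ[k] R') : α.comp (c1 : H →ₐ[k] R) = c1 := by
  ext x
  simp [c1, AlgHom.convOne_def]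

lemma comp_ci (α : R →ₐ[k] R') (a : H →ₐ[k] R) :
    α.comp (ci a) = ci (α.comp a) := by
  simp [ci, AlgHom.comp_assoc]

lemma ci_cm (a : H →ₐ[k] R) : cm (ci a) a = c1 := by
  have h : cm (HopfAlgebra.antipodeAlgHom k H) (AlgHom.id k H) = c1 := by
    unfold cm c1; rw [AlgHom.antipode_id_cancel]
  have := congrArg (fun f => a.comp f) h
  simpa only [comp_cm, comp_c1, AlgHom.comp_id, ci] using this

lemma cm_ci (a : H →ₐ[k] R) : cm a (ci a) = c1 := by
  have h : cm (AlgHom.id k H) (HopfAlgebra.antipodeAlgHom k H) = c1 := by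
    apply AlgHom.toLinearMap_injective
    apply WithConv.toConv_injective
    exact LinearMap.id_mul_antipode
  have := congrArg (fun f => a.comp f) h
  simpa only [comp_cm, comp_c1, AlgHom.comp_id, ci] using this

lemma ci_unique (a b : H →ₐ[k] R) (h : cm a b = c1) : ci a = b := by
  rw [← cm_c1 (ci a), ← h, ← cm_assoc, ci_cm, c1_cm]

lemma ci_mul (a b : H →ₐ[k] R) : ci (cm a b) = cm (ci b) (ci a) := by
  apply ci_unique
  rw [cm_assoc, ← cm_assoc b, cm_ci, c1_cm, cm_ci]

lemma ci_ci (a : H →ₐ[k] R) : ci (ci a) = a := ci_unique _ _ (ci_cm a)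

lemma antipode_sq (h : H) : HopfAlgebra.antipode k (HopfAlgebra.antipode k h) = h :=
  DFunLike.congr_fun (ci_ci (AlgHom.id k H)) h

lemma cm_includes : cm (Algebra.TensorProduct.includeLeft : H →ₐ[k] H ⊗[k] H)
    Algebra.TensorProduct.includeRight = Bialgebra.comulAlgHom k H := by
  ext x
  have := AlgHom.convMul_apply (toConv (Algebra.TensorProduct.includeLeft : H →ₐ[k] H ⊗[k] H))
    (toConv Algebra.TensorProduct.includeRight) x
  refine this.trans ?_
  simp

open Algebra.TensorProduct in
/-- The conjugation coaction at an `R`-point. -/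
def gam (φ : H →ₐ[k] R) : H →ₐ[k] H ⊗[k] R :=
  cm (cm (ci (includeRight.comp φ)) includeLeft) (includeRight.comp φ)

open Algebra.TensorProduct in
/-- The conjugation coaction at an `R`-point, extended. -/
def Gam (φ : H →ₐ[k] R) : H ⊗[k] R →ₐ[k] H ⊗[k] R :=
  lift (gam φ) includeRight (fun _ _ => Commute.all _ _)

lemma Gam_left (φ : H →ₐ[k] R) (h : H) : Gam φ (h ⊗ₜ 1) = gam φ h := by
  simp [Gam, ← Algebra.TensorProduct.one_def]

open Algebra.TensorProduct in
lemma Gam_gam (φ ψ : H →ₐ[k] R) : (Gam φ).comp (gam ψ) = gam (cm φ ψ) := by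
  have h1 : (Gam φ).comp includeLeft = gam φ := by ext x; simp [Gam]
  have h2 : (Gam φ).comp (includeRight.comp ψ) = includeRight.comp ψ := by ext x; simp [Gam]
  conv_lhs => rw [gam, comp_cm, comp_cm, comp_ci, h1, h2]
  rw [gam, gam, comp_cm, ci_mul]
  simp only [cm_assoc]

open Algebra.TensorProduct in
lemma gam_c1 : gam (c1 : H →ₐ[k] R) = includeLeft := by
  rw [gam, comp_c1, ci_unique c1 c1 (c1_cm _), c1_cm, cm_c1]

open Algebra.TensorProduct in
lemma map_gam (φ : H →ₐ[k] R) (α : R →ₐ[k] R') :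
    (map (AlgHom.id k H) α).comp (gam φ) = gam (α.comp φ) := by
  have h1 : (map (AlgHom.id k H) α).comp includeLeft = includeLeft := by ext x; simp
  have h2 : (map (AlgHom.id k H) α).comp (includeRight.comp φ)
    = includeRight.comp (α.comp φ) := by ext x; simp
  rw [gam, comp_cm, comp_cm, comp_ci, h1, h2, gam]

lemma gam_id_apply {ι : Type} (h : H) (s : Finset ι) (a b c : ι → H)
    (hs : (∑ i ∈ s, (a i ⊗ₜ[k] b i) ⊗ₜ[k] c i) = Delta2 k H h) :
    gam (AlgHom.id k H) h =
      ∑ i ∈ s, b i ⊗ₜ[k] (c i * HopfAlgebra.antipode k (a i)) := by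
  have h1 : ∀ x y z : H →ₐ[k] H ⊗[k] H, cm (cm x y) z h =
      ∑ i ∈ s, x (a i) * y (b i) * z (c i) := by
    intro x y z
    have e : ∀ (x y : H →ₐ[k] H ⊗[k] H) (h : H), cm x y h = LinearMap.mul' k (H ⊗[k] H)
      (TensorProduct.map x.toLinearMap y.toLinearMap (Coalgebra.comul h)) := fun _ _ _ => rfl
    have e2 : cm (cm x y) z h = LinearMap.mul' k (H ⊗[k] H)
      (TensorProduct.map (LinearMap.mul' k (H ⊗[k] H) ∘ₗ
        (TensorProduct.map x.toLinearMap y.toLinearMap)) z.toLinearMap (Delta2 k H h)) := by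
      rw [e, Delta2, LinearMap.comp_apply]
      generalize (Coalgebra.comul h : H ⊗[k] H) = w
      induction w using TensorProduct.induction_on with
      | zero => simp
      | tmul u v => rfl
      | add u v hu hv => simp only [map_add, hu, hv]
    rw [e2, ← hs]
    simp
  rw [gam, h1]
  apply Finset.sum_congr rfl
  intro i _
  simp [ci, mul_comm]

end Conv

section Points

variable {k H : Type} [Field k] [CommRing H] [HopfAlgebra k H]
variable {R : Type} [CommRing R] [Algebra k R] {R' : Type} [CommRing R'] [Algebra k R']
variable {M : Type} [AddCommGroup M] [Module k M]

/-- The action of an `R`-point on `M ⊗ R`. -/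
def T (ρ : M →ₗ[k] M ⊗[k] H) (φ : H →ₐ[k] R) : M ⊗[k] R →ₗ[k] M ⊗[k] R :=
  (LinearMap.lTensor M (LinearMap.mul' k R ∘ₗ TensorProduct.map φ.toLinearMap LinearMap.id)) ∘ₗ
    (TensorProduct.assoc k M H R).toLinearMap ∘ₗ LinearMap.rTensor R ρ

lemma T_tmul (ρ : M →ₗ[k] M ⊗[k] H) (φ : H →ₐ[k] R) (m : M) (r : R) :
    T ρ φ (m ⊗ₜ r) = LinearMap.lTensor M (LinearMap.mulRight k r ∘ₗ φ.toLinearMap) (ρ m) := by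
  simp only [T, LinearMap.comp_apply, LinearMap.rTensor_tmul]
  generalize ρ m = w
  induction w using TensorProduct.induction_on with
  | zero => simp
  | tmul u v => simp
  | add u v hu hv => simp only [map_add, add_tmul, hu, hv]

lemma T_one_tmul (ρ : M →ₗ[k] M ⊗[k] H) (φ : H →ₐ[k] R) (m : M) :
    T ρ φ (m ⊗ₜ 1) = LinearMap.lTensor M φ.toLinearMap (ρ m) := by
  rw [T_tmul]; congr 2; ext x; simp

lemma T_id_tmul (ρ : M →ₗ[k] M ⊗[k] H) (m : M) :
    T ρ (AlgHom.id k H) (m ⊗ₜ 1) = ρ m := by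
  rw [T_one_tmul]; exact LinearMap.lTensor_id_apply _ _ _

lemma T_nat (ρ : M →ₗ[k] M ⊗[k] H) (φ : H →ₐ[k] R) (α : R →ₐ[k] R') (x : M ⊗[k] R) :
    LinearMap.lTensor M α.toLinearMap (T ρ φ x) =
      T ρ (α.comp φ) (LinearMap.lTensor M α.toLinearMap x) := by
  induction x using TensorProduct.induction_on with
  | zero => simp
  | tmul m r =>
    rw [LinearMap.lTensor_tmul, T_tmul, T_tmul, ← LinearMap.comp_apply, ← LinearMap.lTensor_comp]
    congr 2
    ext x
    simp
  | add u v hu hv => simp only [map_add, hu, hv]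

lemma T_lTensor (ρ : M →ₗ[k] M ⊗[k] H) (φ ψ : H →ₐ[k] R) (r : R) (z : M ⊗[k] H) :
    T ρ φ (LinearMap.lTensor M (LinearMap.mulRight k r ∘ₗ ψ.toLinearMap) z) =
      LinearMap.lTensor M (LinearMap.mulRight k r ∘ₗ LinearMap.mul' k R ∘ₗ
        TensorProduct.map φ.toLinearMap ψ.toLinearMap)
        (TensorProduct.assoc k M H H (LinearMap.rTensor H ρ z)) := by
  induction z using TensorProduct.induction_on with
  | zero => simp
  | tmul m h =>
    rw [LinearMap.lTensor_tmul, T_tmul, LinearMap.rTensor_tmul]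
    generalize ρ m = w
    induction w using TensorProduct.induction_on with
    | zero => simp
    | tmul u v => simp [mul_assoc]
    | add u v hu hv => simp only [map_add, add_tmul, hu, hv]
  | add u v hu hv => simp only [map_add, hu, hv]

lemma T_mul {ρ : M →ₗ[k] M ⊗[k] H} (hρ : IsComod k H ρ) (φ ψ : H →ₐ[k] R) (x : M ⊗[k] R) :
    T ρ φ (T ρ ψ x) = T ρ (cm φ ψ) x := by
  induction x using TensorProduct.induction_on with
  | zero => simp
  | tmul m r =>
    rw [T_tmul, T_lTensor, hρ.2, T_tmul, ← LinearMap.comp_apply, ← LinearMap.lTensor_comp]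
    rfl
  | add u v hu hv => simp only [map_add, hu, hv]

lemma T_c1_tmul (ρ : M →ₗ[k] M ⊗[k] H) (m : M) (r : R) :
    T ρ c1 (m ⊗ₜ r) = ((TensorProduct.rid k M)
      ((LinearMap.lTensor M (Coalgebra.counit (R := k) (A := H))) (ρ m))) ⊗ₜ r := by
  rw [T_tmul]
  generalize ρ m = w
  induction w using TensorProduct.induction_on with
  | zero => simp
  | tmul u v =>
    simp only [LinearMap.lTensor_tmul, TensorProduct.rid_tmul, TensorProduct.smul_tmul]
    simp [c1, AlgHom.convOne_def, Algebra.smul_def]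
  | add u v hu hv => simp only [map_add, add_tmul, hu, hv]

lemma T_c1 {ρ : M →ₗ[k] M ⊗[k] H} (hρ : IsComod k H ρ) (x : M ⊗[k] R) :
    T ρ c1 x = x := by
  induction x using TensorProduct.induction_on with
  | zero => simp
  | tmul m r => rw [T_c1_tmul, hρ.1]
  | add u v hu hv => simp only [map_add, hu, hv]

lemma isComod_of_T {ρ : M →ₗ[k] M ⊗[k] H}
    (h1 : ∀ m : M, T ρ (c1 : H →ₐ[k] H) (m ⊗ₜ 1) = m ⊗ₜ 1)
    (h2 : ∀ (φ ψ : H →ₐ[k] H ⊗[k] H) (m : M), T ρ φ (T ρ ψ (m ⊗ₜ 1)) = T ρ (cm φ ψ) (m ⊗ₜ 1)) :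
    IsComod k H ρ := by
  constructor
  · intro m
    have := congrArg (fun x => TensorProduct.rid k M
      (LinearMap.lTensor M (Coalgebra.counit (R := k) (A := H)) x)) (h1 m)
    rw [T_c1_tmul] at this
    simpa using this
  · intro m
    have h := h2 Algebra.TensorProduct.includeLeft Algebra.TensorProduct.includeRight m
    rw [T_tmul, T_lTensor, cm_includes, T_one_tmul] at h
    refine Eq.trans ?_ h
    have e : (LinearMap.mulRight k 1 ∘ₗ LinearMap.mul' k (H ⊗[k] H) ∘ₗ
        TensorProduct.map (Algebra.TensorProduct.includeLeft : H →ₐ[k] H ⊗[k] H).toLinearMap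
          (Algebra.TensorProduct.includeRight : H →ₐ[k] H ⊗[k] H).toLinearMap) =
        LinearMap.id := by
      apply TensorProduct.ext'
      intro x y
      simp
    rw [e, LinearMap.lTensor_id_apply]

variable [Module H M] [IsScalarTower k H M]

/-- The action of `H ⊗ R` on `M ⊗ R`. -/
def L (R M : Type) [CommRing R] [Algebra k R] [AddCommGroup M] [Module k M] [Module H M]
    [IsScalarTower k H M] : H ⊗[k] R →ₐ[k] Module.End k (M ⊗[k] R) :=
  (Module.endTensorEndAlgHom (R := k) (S := k) (A := k) (M := M) (N := R)).comp
    (Algebra.TensorProduct.map (Algebra.lsmul k k M) (Algebra.lmul k R))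

@[simp] lemma L_tmul (h : H) (r : R) (m : M) (s : R) :
    L (k := k) R M (h ⊗ₜ r) (m ⊗ₜ s) = (h • m) ⊗ₜ (r * s) := rfl

lemma L_mul (u v : H ⊗[k] R) (x : M ⊗[k] R) : L R M (u * v) x = L R M u (L R M v x) := by
  rw [map_mul]; rfl

lemma T_L1 (ρ : M →ₗ[k] M ⊗[k] H) (φ : H →ₐ[k] R) (r : R) (x : M ⊗[k] R) :
    T ρ φ (L R M ((1 : H) ⊗ₜ r) x) = L R M ((1 : H) ⊗ₜ r) (T ρ φ x) := by
  induction x using TensorProduct.induction_on with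
  | zero => simp
  | tmul m s =>
    rw [L_tmul, T_tmul, one_smul, T_tmul]
    generalize ρ m = w
    induction w using TensorProduct.induction_on with
    | zero => simp
    | tmul u v => simp [mul_left_comm, mul_assoc]
    | add u v hu hv => simp only [map_add, hu, hv]
  | add u v hu hv => simp only [map_add, hu, hv]

lemma L_nat (α : R →ₐ[k] R') (w : H ⊗[k] R) (x : M ⊗[k] R) :
    LinearMap.lTensor M α.toLinearMap (L R M w x) =
      L R' M (Algebra.TensorProduct.map (AlgHom.id k H) α w)
        (LinearMap.lTensor M α.toLinearMap x) := by
  induction w using TensorProduct.induction_on with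
  | zero => simp
  | add u v hu hv => simp only [map_add, LinearMap.add_apply, hu, hv]
  | tmul h r =>
    induction x using TensorProduct.induction_on with
    | zero => simp
    | tmul m s => simp
    | add u v hu hv => simp only [map_add, hu, hv]

/-- Yetter-Drinfeld compatibility, reformulated. -/
def Compat' (ρ : M →ₗ[k] M ⊗[k] H) : Prop :=
  ∀ (h : H) (m : M), ρ (h • m) = L H M (gam (AlgHom.id k H) h) (ρ m)

lemma T_L {ρ : M →ₗ[k] M ⊗[k] H} (hρ : Compat' ρ) (φ : H →ₐ[k] R) (w : H ⊗[k] R)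
    (x : M ⊗[k] R) : T ρ φ (L R M w x) = L R M (Gam φ w) (T ρ φ x) := by
  have key : ∀ (h : H) (m : M), T ρ φ ((h • m) ⊗ₜ 1) = L R M (gam φ h) (T ρ φ (m ⊗ₜ 1)) := by
    intro h m
    rw [T_one_tmul, hρ, L_nat, T_one_tmul]
    congr 2
    exact DFunLike.congr_fun (map_gam (AlgHom.id k H) φ) h
  induction w using TensorProduct.induction_on with
  | zero => simp
  | add u v hu hv => simp only [map_add, LinearMap.add_apply, hu, hv]
  | tmul h r =>
    induction x using TensorProduct.induction_on with
    | zero => simp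
    | tmul m s =>
      have e1 : L R M (h ⊗ₜ[k] r) (m ⊗ₜ[k] s) = L R M ((1 : H) ⊗ₜ[k] (r * s)) ((h • m) ⊗ₜ 1) := by
        simp
      have e2 : m ⊗ₜ[k] s = L R M ((1 : H) ⊗ₜ[k] s) (m ⊗ₜ[k] (1 : R)) := by simp
      rw [e1, T_L1, key, e2, T_L1, ← L_mul, ← L_mul]
      congr 2
      simp only [Gam, Algebra.TensorProduct.lift_tmul, Algebra.TensorProduct.includeRight_apply]
      rw [mul_assoc, Algebra.TensorProduct.tmul_mul_tmul, one_mul, mul_comm]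
    | add u v hu hv => simp only [map_add, hu, hv]

lemma exists_nat_repr {V W : Type} [AddCommGroup V] [Module k V] [AddCommGroup W] [Module k W]
    (x : V ⊗[k] W) : ∃ (t : Finset ℕ) (a : ℕ → V) (b : ℕ → W), ∑ j ∈ t, a j ⊗ₜ[k] b j = x := by
  induction x using TensorProduct.induction_on with
  | zero => exact ⟨∅, 0, 0, by simp⟩
  | tmul v w => exact ⟨{0}, fun _ => v, fun _ => w, by simp⟩
  | add x y hx hy =>
    obtain ⟨s, a, b, rfl⟩ := hx
    obtain ⟨t, c, d, rfl⟩ := hy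
    classical
    let e : s ⊕ t ↪ ℕ := ⟨Encodable.encode, Encodable.encode_injective⟩
    refine ⟨Finset.univ.map e, fun n => (Encodable.decode (α := s ⊕ t) n).elim 0
        (Sum.elim (fun i => a i) (fun i => c i)), fun n =>
        (Encodable.decode (α := s ⊕ t) n).elim 0 (Sum.elim (fun i => b i) (fun i => d i)), ?_⟩
    rw [Finset.sum_map, Fintype.sum_sum_type]
    simp only [e, Function.Embedding.coeFn_mk, Encodable.encodek, Option.elim_some, Sum.elim_inl,
      Sum.elim_inr]
    rw [Finset.sum_coe_sort s (fun i => a i ⊗ₜ[k] b i),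
      Finset.sum_coe_sort t (fun i => c i ⊗ₜ[k] d i)]

lemma exists_nat_repr3 {U V W : Type} [AddCommGroup U] [Module k U]
    [AddCommGroup V] [Module k V] [AddCommGroup W] [Module k W]
    (x : (U ⊗[k] V) ⊗[k] W) : ∃ (t : Finset ℕ) (a : ℕ → U) (b : ℕ → V) (c : ℕ → W),
      ∑ j ∈ t, (a j ⊗ₜ[k] b j) ⊗ₜ[k] c j = x := by
  obtain ⟨s, p, c, rfl⟩ := exists_nat_repr x
  choose t a b h using fun i => exists_nat_repr (p i)
  classical
  obtain ⟨e⟩ : Nonempty (ℕ × ℕ ≃ ℕ) := ⟨Nat.pairEquiv⟩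
  refine ⟨(s.sigma t).map ⟨fun x => e (x.1, x.2), fun x y hxy => by
    rcases x with ⟨x1, x2⟩; rcases y with ⟨y1, y2⟩
    have := e.injective hxy
    simp at this; obtain ⟨rfl, rfl⟩ := this; rfl⟩,
    fun n => a (e.symm n).1 (e.symm n).2, fun n => b (e.symm n).1 (e.symm n).2,
    fun n => c (e.symm n).1, ?_⟩
  rw [Finset.sum_map, Finset.sum_sigma]
  refine Finset.sum_congr rfl fun i _ => ?_
  rw [← h, TensorProduct.sum_tmul]
  refine Finset.sum_congr rfl fun j _ => ?_
  change (a (e.symm (e (i, j))).1 (e.symm (e (i, j))).2 ⊗ₜ[k]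
    b (e.symm (e (i, j))).1 (e.symm (e (i, j))).2) ⊗ₜ[k] c (e.symm (e (i, j))).1 = _
  rw [e.symm_apply_apply]

lemma L_sum (Sinv : H →ₗ[k] H) (hS : ∀ h, Sinv h = HopfAlgebra.antipode k h)
    (h : H) (s t : Finset ℕ) (a b c : ℕ → H) (m₀ : ℕ → M) (m₁ : ℕ → H)
    (hs : (∑ i ∈ s, (a i ⊗ₜ[k] b i) ⊗ₜ[k] c i) = Delta2 k H h) :
    L H M (gam (AlgHom.id k H) h) (∑ j ∈ t, m₀ j ⊗ₜ[k] m₁ j) =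
      ∑ i ∈ s, ∑ j ∈ t, (b i • m₀ j) ⊗ₜ[k] (c i * m₁ j * Sinv (a i)) := by
  rw [gam_id_apply h s a b c hs]
  simp only [map_sum, LinearMap.sum_apply, L_tmul, hS]
  rw [Finset.sum_comm]
  refine Finset.sum_congr rfl fun i _ => Finset.sum_congr rfl fun j _ => ?_
  congr 1; ring

lemma compat_iff (Sinv : H →ₗ[k] H) (hS : ∀ h, Sinv h = HopfAlgebra.antipode k h)
    (ρ : M →ₗ[k] M ⊗[k] H) : IsYDCompat k H Sinv ρ ↔ Compat' ρ := by
  constructor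
  · intro hc h m
    obtain ⟨s, a, b, c, hs⟩ := exists_nat_repr3 (Delta2 k H h)
    obtain ⟨t, m₀, m₁, ht⟩ := exists_nat_repr (ρ m)
    rw [hc h m s t a b c m₀ m₁ hs ht, ← ht, L_sum Sinv hS h s t a b c m₀ m₁ hs]
  · intro hc h m s t a b c m₀ m₁ hs ht
    rw [hc, ← ht, L_sum Sinv hS h s t a b c m₀ m₁ hs]

end Points

section Contract

variable {k : Type} [Field k]
variable {N N' W : Type} [AddCommGroup N] [Module k N] [AddCommGroup N'] [Module k N']
  [AddCommGroup W] [Module k W]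

/-- Contraction along a functional. -/
def ctr (φ : W →ₗ[k] k) : N ⊗[k] W →ₗ[k] N :=
  (TensorProduct.rid k N).toLinearMap.comp (LinearMap.lTensor N φ)

@[simp] lemma ctr_tmul (φ : W →ₗ[k] k) (n : N) (w : W) : ctr φ (n ⊗ₜ[k] w) = φ w • n := by
  simp [ctr]

lemma ctr_rTensor (φ : W →ₗ[k] k) (f : N →ₗ[k] N') (y : N ⊗[k] W) :
    ctr φ (LinearMap.rTensor W f y) = f (ctr φ y) := by
  induction y using TensorProduct.induction_on with
  | zero => simp
  | tmul n w => simp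
  | add u v hu hv => simp only [map_add, hu, hv]

lemma ctr_sum {ι : Type} (b : Module.Basis ι k W) (y : N ⊗[k] W) :
    ∃ I : Finset ι, ∀ J : Finset ι, I ⊆ J → y = ∑ i ∈ J, ctr (b.coord i) y ⊗ₜ[k] b i := by
  classical
  induction y using TensorProduct.induction_on with
  | zero => exact ⟨∅, fun J _ => by simp⟩
  | tmul n w =>
    refine ⟨(b.repr w).support, fun J hJ => ?_⟩
    have : w = ∑ i ∈ J, b.repr w i • b i := by
      conv_lhs => rw [← b.linearCombination_repr w, Finsupp.linearCombination_apply]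
      exact Finsupp.sum_of_support_subset _ hJ _ (by simp)
    conv_lhs => rw [this, TensorProduct.tmul_sum]
    simp [TensorProduct.smul_tmul]
  | add u v hu hv =>
    obtain ⟨I, hI⟩ := hu
    obtain ⟨I', hI'⟩ := hv
    refine ⟨I ∪ I', fun J hJ => ?_⟩
    conv_lhs => rw [hI J (Finset.union_subset_left hJ), hI' J (Finset.union_subset_right hJ)]
    rw [← Finset.sum_add_distrib]
    simp only [map_add, add_tmul]

lemma ctr_ext (y : N ⊗[k] W) (h : ∀ φ : W →ₗ[k] k, ctr φ y = 0) : y = 0 := by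
  obtain ⟨I, hI⟩ := ctr_sum (Module.Basis.ofVectorSpace k W) y
  rw [hI I subset_rfl]
  simp [h]

end Contract

section HomObj

variable {k H : Type} [Field k] [CommRing H] [HopfAlgebra k H]
variable {R : Type} [CommRing R] [Algebra k R] {R' : Type} [CommRing R'] [Algebra k R']
variable {X : Type} [AddCommGroup X] [Module k X] [Module H X] [IsScalarTower k H X]
variable {B : Type} [AddCommGroup B] [Module k B] [Module H B] [IsScalarTower k H B]
  [SMulCommClass H k B]
variable {C : Type} [AddCommGroup C] [Module k C] [Module H C] [IsScalarTower k H C]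
  [SMulCommClass H k C]

/-- Extended evaluation. -/
def E : (X →ₗ[H] B) ⊗[k] R →ₗ[k] (X ⊗[k] R →ₗ[k] B ⊗[k] R) :=
  TensorProduct.homTensorHomMap (.id k) X R B R ∘ₗ
    TensorProduct.map (LinearMap.restrictScalarsₗ k H X B k) (LinearMap.mul k R)

@[simp] lemma E_tmul (f : X →ₗ[H] B) (r : R) (x : X) (s : R) :
    E (k := k) (f ⊗ₜ[k] r) (x ⊗ₜ[k] s) = f x ⊗ₜ[k] (r * s) := rfl

lemma E_L (z : (X →ₗ[H] B) ⊗[k] R) (w : H ⊗[k] R) (x : X ⊗[k] R) :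
    E z (L R X w x) = L R B w (E z x) := by
  induction z using TensorProduct.induction_on with
  | zero => simp
  | add u v hu hv => simp only [map_add, LinearMap.add_apply, hu, hv]
  | tmul f r =>
    induction w using TensorProduct.induction_on with
    | zero => simp
    | add u v hu hv => simp only [map_add, LinearMap.add_apply, hu, hv]
    | tmul h s =>
      induction x using TensorProduct.induction_on with
      | zero => simp
      | add u v hu hv => simp only [map_add, hu, hv]
      | tmul m t => simp [mul_left_comm]

lemma E_L' (z : (X →ₗ[H] B) ⊗[k] R) (w : H ⊗[k] R) (x : X ⊗[k] R) :
    E (L R (X →ₗ[H] B) w z) x = L R B w (E z x) := by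
  induction z using TensorProduct.induction_on with
  | zero => simp
  | add u v hu hv => simp only [map_add, LinearMap.add_apply, hu, hv]
  | tmul f r =>
    induction w using TensorProduct.induction_on with
    | zero => simp
    | add u v hu hv => simp only [map_add, LinearMap.add_apply, hu, hv]
    | tmul h s =>
      induction x using TensorProduct.induction_on with
      | zero => simp
      | add u v hu hv => simp only [map_add, hu, hv]
      | tmul m t => simp [mul_assoc]

lemma E_nat (α : R →ₐ[k] R') (z : (X →ₗ[H] B) ⊗[k] R) (x : X ⊗[k] R) :
    LinearMap.lTensor B α.toLinearMap (E z x) =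
      E (LinearMap.lTensor _ α.toLinearMap z) (LinearMap.lTensor X α.toLinearMap x) := by
  induction z using TensorProduct.induction_on with
  | zero => simp
  | add u v hu hv => simp only [map_add, LinearMap.add_apply, hu, hv]
  | tmul f r =>
    induction x using TensorProduct.induction_on with
    | zero => simp
    | add u v hu hv => simp only [map_add, hu, hv]
    | tmul m t => simp

lemma E_ctr (φ : R →ₗ[k] k) (z : (X →ₗ[H] B) ⊗[k] R) (m : X) :
    ctr φ (E z (m ⊗ₜ 1)) = ctr φ z m := by
  induction z using TensorProduct.induction_on with
  | zero => simp
  | add u v hu hv => simp only [map_add, LinearMap.add_apply, hu, hv]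
  | tmul f r => simp

lemma E_inj {z z' : (X →ₗ[H] B) ⊗[k] R} (h : ∀ m, E z (m ⊗ₜ 1) = E z' (m ⊗ₜ 1)) : z = z' := by
  rw [← sub_eq_zero]
  apply ctr_ext
  intro φ
  ext m
  rw [← E_ctr]
  simp [h]

lemma E_postcomp (g : B →ₗ[k] C) (hg : ∀ (h : H) (m : B), g (h • m) = h • g m)
    [SMulCommClass H k X]
    (z : (X →ₗ[H] B) ⊗[k] R) (x : X ⊗[k] R) :
    E (LinearMap.rTensor R (postcompH (X := X) g hg) z) x = LinearMap.rTensor R g (E z x) := by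
  induction z using TensorProduct.induction_on with
  | zero => simp
  | add u v hu hv => simp only [map_add, LinearMap.add_apply, hu, hv]
  | tmul f r =>
    induction x using TensorProduct.induction_on with
    | zero => simp
    | add u v hu hv => simp only [map_add, hu, hv]
    | tmul m t => rfl

lemma T_rTensor {ρB : B →ₗ[k] B ⊗[k] H} {ρC : C →ₗ[k] C ⊗[k] H} {g : B →ₗ[k] C}
    (hg : ρC.comp g = (LinearMap.rTensor H g).comp ρB) (φ : H →ₐ[k] R) (x : B ⊗[k] R) :
    LinearMap.rTensor R g (T ρB φ x) = T ρC φ (LinearMap.rTensor R g x) := by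
  induction x using TensorProduct.induction_on with
  | zero => simp
  | add u v hu hv => simp only [map_add, hu, hv]
  | tmul m t =>
    have : ρC (g m) = LinearMap.rTensor H g (ρB m) := LinearMap.congr_fun hg m
    rw [LinearMap.rTensor_tmul, T_tmul, T_tmul, this]
    generalize ρB m = w
    induction w using TensorProduct.induction_on with
    | zero => simp
    | add u v hu hv => simp only [map_add, hu, hv]
    | tmul a b => simp

lemma ctr_L (φ : R →ₗ[k] k) (h : H) (y : B ⊗[k] R) :
    ctr φ (L R B (h ⊗ₜ[k] (1 : R)) y) = h • ctr φ y := by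
  induction y using TensorProduct.induction_on with
  | zero => simp
  | add u v hu hv => simp only [map_add, smul_add, hu, hv]
  | tmul m t =>
    simp only [L_tmul, ctr_tmul, one_mul]
    exact smul_comm _ _ _

lemma exists_E [Module.Finite H X] (G : X →ₗ[k] B ⊗[k] R)
    (hG : ∀ (h : H) (m : X), G (h • m) = L R B (h ⊗ₜ[k] (1 : R)) (G m)) :
    ∃ z : (X →ₗ[H] B) ⊗[k] R, ∀ m, E z (m ⊗ₜ 1) = G m := by
  classical
  let b := Module.Basis.ofVectorSpace k R
  let g : ∀ _ : Module.Basis.ofVectorSpaceIndex k R, X →ₗ[H] B := fun i =>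
    { toFun := fun m => ctr (b.coord i) (G m)
      map_add' := fun x y => by simp
      map_smul' := fun h x => by rw [hG, ctr_L]; rfl }
  obtain ⟨S, hS⟩ := (Module.Finite.fg_top : (⊤ : Submodule H X).FG)
  choose I hI using fun m : X => ctr_sum b (G m)
  refine ⟨∑ i ∈ S.biUnion I, g i ⊗ₜ[k] b i, fun m => ?_⟩
  have hm : m ∈ Submodule.span H (S : Set X) := by rw [hS]; trivial
  induction hm using Submodule.span_induction with
  | mem x hx =>
    rw [hI x (S.biUnion I) (Finset.subset_biUnion_of_mem I hx)]
    simp [g, LinearMap.sum_apply]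
  | zero => simp
  | add x y _ _ hx hy => simp only [add_tmul, map_add, hx, hy]
  | smul h x _ hx =>
    rw [hG, ← hx, ← E_L]
    simp

variable {ρX : X →ₗ[k] X ⊗[k] H} {ρB : B →ₗ[k] B ⊗[k] H} {ρC : C →ₗ[k] C ⊗[k] H}

lemma exists_rhoQ [Module.Finite H X] (cX : Compat' ρX) (cB : Compat' ρB) :
    ∃ ρQ : (X →ₗ[H] B) →ₗ[k] (X →ₗ[H] B) ⊗[k] H, ∀ f m,
      E (ρQ f) (m ⊗ₜ 1) = T ρB (AlgHom.id k H) (E (f ⊗ₜ[k] (1 : H))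
        (T ρX (ci (AlgHom.id k H)) (m ⊗ₜ 1))) := by
  have key : ∀ f : X →ₗ[H] B, ∃ z : (X →ₗ[H] B) ⊗[k] H, ∀ m,
      E z (m ⊗ₜ 1) = T ρB (AlgHom.id k H) (E (f ⊗ₜ[k] (1 : H))
        (T ρX (ci (AlgHom.id k H)) (m ⊗ₜ 1))) := by
    intro f
    refine exists_E ((T ρB (AlgHom.id k H)) ∘ₗ (E (f ⊗ₜ[k] (1 : H))) ∘ₗ
      (T ρX (ci (AlgHom.id k H))) ∘ₗ (TensorProduct.mk k X H).flip 1) ?_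
    intro h m
    simp only [LinearMap.comp_apply, LinearMap.flip_apply, TensorProduct.mk_apply]
    have e1 : (h • m) ⊗ₜ[k] (1 : H) = L H X (h ⊗ₜ[k] (1 : H)) (m ⊗ₜ[k] (1 : H)) := by simp
    rw [e1, T_L cX, E_L, T_L cB, Gam_left]
    congr 2
    have := DFunLike.congr_fun (Gam_gam (AlgHom.id k H) (ci (AlgHom.id k H))) h
    rw [cm_ci, gam_c1] at this
    exact this
  choose r hr using key
  refine ⟨{ toFun := r, map_add' := ?_, map_smul' := ?_ }, hr⟩
  · intro f g
    apply E_inj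
    intro m
    simp only [hr, map_add, LinearMap.add_apply, add_tmul]
  · intro c f
    apply E_inj
    intro m
    simp only [hr, map_smul, LinearMap.smul_apply, RingHom.id_apply, ← smul_tmul']

/-- The coaction on `Hom_H(X, B)`. -/
def rhoQ [Module.Finite H X] (cX : Compat' ρX) (cB : Compat' ρB) :
    (X →ₗ[H] B) →ₗ[k] (X →ₗ[H] B) ⊗[k] H := (exists_rhoQ cX cB).choose

lemma rhoQ_spec [Module.Finite H X] (cX : Compat' ρX) (cB : Compat' ρB) (f : X →ₗ[H] B) (m : X) :
    E (rhoQ cX cB f) (m ⊗ₜ 1) = T ρB (AlgHom.id k H) (E (f ⊗ₜ[k] (1 : H))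
        (T ρX (ci (AlgHom.id k H)) (m ⊗ₜ 1))) := (exists_rhoQ cX cB).choose_spec f m

lemma E_T_rhoQ [Module.Finite H X] (cX : Compat' ρX) (cB : Compat' ρB) (φ : H →ₐ[k] R)
    (z : (X →ₗ[H] B) ⊗[k] R) (x : X ⊗[k] R) :
    E (T (rhoQ cX cB) φ z) x = T ρB φ (E z (T ρX (ci φ) x)) := by
  induction z using TensorProduct.induction_on with
  | zero => simp
  | add u v hu hv => simp only [map_add, LinearMap.add_apply, hu, hv]
  | tmul f r =>
    induction x using TensorProduct.induction_on with
    | zero => simp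
    | add u v hu hv => simp only [map_add, hu, hv]
    | tmul m s =>
      have e1 : f ⊗ₜ[k] r = L R (X →ₗ[H] B) ((1 : H) ⊗ₜ[k] r) (f ⊗ₜ[k] (1 : R)) := by simp
      have e2 : m ⊗ₜ[k] s = L R X ((1 : H) ⊗ₜ[k] s) (m ⊗ₜ[k] (1 : R)) := by simp
      rw [e1, e2, T_L1, T_L1, E_L', E_L, E_L', E_L, T_L1, T_L1]
      congr 2
      have h := congrArg (LinearMap.lTensor B φ.toLinearMap) (rhoQ_spec cX cB f m)
      rw [E_nat, T_nat, E_nat, T_nat, comp_ci, AlgHom.comp_id] at h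
      simp only [LinearMap.lTensor_tmul, AlgHom.toLinearMap_apply, map_one] at h
      rw [T_one_tmul, h]

lemma rhoQ_comod [Module.Finite H X] (cX : Compat' ρX) (cB : Compat' ρB)
    (hX : IsComod k H ρX) (hB : IsComod k H ρB) : IsComod k H (rhoQ cX cB) := by
  apply isComod_of_T
  · intro f
    apply E_inj
    intro m
    rw [E_T_rhoQ, ci_unique c1 c1 (c1_cm _), T_c1 hX, T_c1 hB]
  · intro φ ψ f
    apply E_inj
    intro m
    rw [E_T_rhoQ, E_T_rhoQ, E_T_rhoQ, T_mul hX, T_mul hB, ci_mul]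

lemma rhoQ_compat [Module.Finite H X] (cX : Compat' ρX) (cB : Compat' ρB) :
    Compat' (rhoQ cX cB) := by
  intro h f
  apply E_inj
  intro m
  have e1 : (h • f) ⊗ₜ[k] (1 : H) = L H (X →ₗ[H] B) (h ⊗ₜ[k] (1 : H)) (f ⊗ₜ[k] (1 : H)) := by simp
  rw [E_L', rhoQ_spec, rhoQ_spec, e1, E_L', T_L cB, Gam_left]

lemma rhoQ_nat [Module.Finite H X] [SMulCommClass H k X]
    (cX : Compat' ρX) (cB : Compat' ρB) (cC : Compat' ρC)
    {g : B →ₗ[k] C} (hg : IsHom k H ρB ρC g) :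
    IsHom k H (rhoQ cX cB) (rhoQ cX cC) (postcompH (X := X) g hg.1) := by
  constructor
  · intro h f
    ext m
    exact hg.1 h (f m)
  · apply LinearMap.ext
    intro f
    apply E_inj
    intro m
    simp only [LinearMap.comp_apply]
    rw [rhoQ_spec, E_postcomp, rhoQ_spec, T_rTensor hg.2, ← E_postcomp _ hg.1,
      LinearMap.rTensor_tmul]

lemma E_one (f : X →ₗ[H] B) (x : X ⊗[k] R) :
    E (f ⊗ₜ[k] (1 : R)) x = LinearMap.rTensor R (f.restrictScalars k) x := by
  induction x using TensorProduct.induction_on with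
  | zero => simp
  | add u v hu hv => simp only [map_add, hu, hv]
  | tmul m s => simp

lemma rhoQ_coinv [Module.Finite H X] (cX : Compat' ρX) (cB : Compat' ρB)
    (hX : IsComod k H ρX) (f : X →ₗ[H] B)
    (hf : f ∈ coinv (rhoQ cX cB)) : IsHom k H ρX ρB (f.restrictScalars k) := by
  refine ⟨fun h a => by simp, LinearMap.ext fun m => ?_⟩
  rw [mem_coinv] at hf
  have h1 := E_T_rhoQ cX cB (AlgHom.id k H) (f ⊗ₜ[k] (1 : H)) (ρX m)
  rw [T_id_tmul, hf, ← T_id_tmul ρX m, T_mul hX, ci_cm, T_c1 hX, T_id_tmul, E_tmul, mul_one,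
    T_id_tmul, E_one] at h1
  exact h1.symm

lemma rhoQ_id [Module.Finite H B] (cB : Compat' ρB) (hB : IsComod k H ρB) :
    LinearMap.id ∈ coinv (rhoQ cB cB) := by
  rw [mem_coinv]
  apply E_inj
  intro m
  have h : ∀ x : B ⊗[k] H, E ((LinearMap.id : B →ₗ[H] B) ⊗ₜ[k] (1 : H)) x = x := by
    intro x
    rw [E_one]; exact LinearMap.rTensor_id_apply _ _ _
  rw [rhoQ_spec, h, h, T_mul hB, cm_ci, T_c1 hB]

end HomObj

section Transport

variable {k H : Type} [Field k] [CommRing H] [HopfAlgebra k H]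
variable {R : Type} [CommRing R] [Algebra k R]
variable {A : Type} [AddCommGroup A] [Module k A] [Module H A] [IsScalarTower k H A]
  [SMulCommClass H k A]
variable {B : Type} [AddCommGroup B] [Module k B] [Module H B] [IsScalarTower k H B]
  [SMulCommClass H k B]
variable {ρA : A →ₗ[k] A ⊗[k] H} {ρB : B →ₗ[k] B ⊗[k] H} {f : A →ₗ[k] B}

lemma rTensor_L (hf : ∀ (h : H) (a : A), f (h • a) = h • f a) (w : H ⊗[k] R) (y : A ⊗[k] R) :
    LinearMap.rTensor R f (L R A w y) = L R B w (LinearMap.rTensor R f y) := by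
  induction w using TensorProduct.induction_on with
  | zero => simp
  | add u v hu hv => simp only [map_add, LinearMap.add_apply, hu, hv]
  | tmul h s =>
    induction y using TensorProduct.induction_on with
    | zero => simp
    | add u v hu hv => simp only [map_add, hu, hv]
    | tmul m t => simp [hf]

lemma rTensor_inj (hi : Function.Injective f) (W : Type) [AddCommGroup W] [Module k W] :
    Function.Injective (LinearMap.rTensor W f) :=
  Module.Flat.rTensor_preserves_injective_linearMap f hi

lemma comod_of_inj (hf : IsHom k H ρA ρB f) (hi : Function.Injective f) (hB : IsComod k H ρB) :
    IsComod k H ρA := by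
  apply isComod_of_T
  · intro m
    apply rTensor_inj hi
    rw [T_rTensor hf.2, T_c1 hB]
  · intro φ ψ m
    apply rTensor_inj hi
    rw [T_rTensor hf.2, T_rTensor hf.2, T_mul hB, T_rTensor hf.2]

lemma compat_of_inj (hf : IsHom k H ρA ρB f) (hi : Function.Injective f) (hB : Compat' ρB) :
    Compat' ρA := by
  have h2 : ∀ a, ρB (f a) = LinearMap.rTensor H f (ρA a) := fun a => LinearMap.congr_fun hf.2 a
  intro h m
  apply rTensor_inj hi
  rw [rTensor_L hf.1, ← h2, ← h2, hf.1, hB]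

lemma comod_of_surj (hf : IsHom k H ρA ρB f) (hs : Function.Surjective f) (hA : IsComod k H ρA) :
    IsComod k H ρB := by
  apply isComod_of_T
  · intro m
    obtain ⟨a, rfl⟩ := hs m
    rw [← LinearMap.rTensor_tmul, ← T_rTensor hf.2, T_c1 hA]
  · intro φ ψ m
    obtain ⟨a, rfl⟩ := hs m
    rw [← LinearMap.rTensor_tmul, ← T_rTensor hf.2, ← T_rTensor hf.2, T_mul hA, T_rTensor hf.2]

lemma compat_of_surj (hf : IsHom k H ρA ρB f) (hs : Function.Surjective f) (hA : Compat' ρA) :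
    Compat' ρB := by
  have h2 : ∀ a, ρB (f a) = LinearMap.rTensor H f (ρA a) := fun a => LinearMap.congr_fun hf.2 a
  intro h m
  obtain ⟨a, rfl⟩ := hs m
  rw [← hf.1, h2, hA, h2, rTensor_L hf.1]

lemma rhoQ_hom_coinv [Module.Finite H A] (cA : Compat' ρA) (cB : Compat' ρB)
    (hA : IsComod k H ρA) (g : A →ₗ[H] B)
    (hg : IsHom k H ρA ρB (g.restrictScalars k)) : g ∈ coinv (rhoQ cA cB) := by
  rw [mem_coinv]
  apply E_inj
  intro m
  rw [rhoQ_spec, E_one, ← T_rTensor hg.2, T_mul hA, cm_ci, T_c1 hA, E_one]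

lemma mem_range_rTensor {V : Type} [AddCommGroup V] [Module k V] {W : Type} [AddCommGroup W]
    [Module k W] (p : Submodule k V) (y : V ⊗[k] W) :
    y ∈ LinearMap.range (LinearMap.rTensor W p.subtype) ↔ ∀ φ : W →ₗ[k] k, ctr φ y ∈ p := by
  constructor
  · rintro ⟨z, rfl⟩ φ
    rw [ctr_rTensor]
    exact (ctr φ z).2
  · intro h
    obtain ⟨I, hI⟩ := ctr_sum (Module.Basis.ofVectorSpace k W) y
    rw [hI I subset_rfl]
    refine Submodule.sum_mem _ fun i _ => ?_
    exact ⟨(⟨_, h ((Module.Basis.ofVectorSpace k W).coord i)⟩ : p) ⊗ₜ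
      (Module.Basis.ofVectorSpace k W i), by simp⟩

lemma isSubobject_iff (ρ : A →ₗ[k] A ⊗[k] H) (p : Submodule H A) :
    IsSubobject ρ p ↔ ∀ m ∈ p, ∀ φ : H →ₗ[k] k, ctr φ (ρ m) ∈ p := by
  unfold IsSubobject
  simp only [mem_range_rTensor, Submodule.restrictScalars_mem]

end Transport

section Objs

variable {k H : Type} [Field k] [CommRing H] [HopfAlgebra k H] {Sinv : H →ₗ[k] H}

lemma exists_sub (hS : ∀ h, Sinv h = HopfAlgebra.antipode k h) (A : YDCat k H Sinv)
    (p : Submodule H A.M) (hp : IsSubobject A.ρ p) :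
    ∃ ρ : p →ₗ[k] p ⊗[k] H, IsHom k H ρ A.ρ (p.subtype.restrictScalars k) ∧
      IsComod k H ρ ∧ Compat' ρ := by
  have hi : Function.Injective (p.subtype.restrictScalars k) := p.injective_subtype
  obtain ⟨r, hr⟩ := LinearMap.exists_leftInverse_of_injective (p.subtype.restrictScalars k)
    (LinearMap.ker_eq_bot.2 hi)
  have hom : IsHom k H (LinearMap.rTensor H r ∘ₗ A.ρ ∘ₗ p.subtype.restrictScalars k) A.ρ
      (p.subtype.restrictScalars k) := by
    refine ⟨fun h a => rfl, LinearMap.ext fun a => ?_⟩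
    simp only [LinearMap.comp_apply]
    obtain ⟨z, hz⟩ : ∃ z, LinearMap.rTensor H (p.subtype.restrictScalars k) z = A.ρ a :=
      hp a a.2
    change A.ρ a = LinearMap.rTensor H _ (LinearMap.rTensor H r (A.ρ a))
    rw [← hz, ← LinearMap.rTensor_comp_apply H r, hr, LinearMap.rTensor_id_apply]
  exact ⟨_, hom, comod_of_inj hom hi A.comod,
    compat_of_inj hom hi ((compat_iff Sinv hS _).1 A.compat)⟩

lemma exists_quot (hS : ∀ h, Sinv h = HopfAlgebra.antipode k h) (A : YDCat k H Sinv)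
    (p : Submodule H A.M) (hp : IsSubobject A.ρ p) :
    ∃ ρ : (A.M ⧸ p) →ₗ[k] (A.M ⧸ p) ⊗[k] H, IsHom k H A.ρ ρ (p.mkQ.restrictScalars k) ∧
      IsComod k H ρ ∧ Compat' ρ := by
  have hs : Function.Surjective (p.mkQ.restrictScalars k) := p.mkQ_surjective
  obtain ⟨r, hr⟩ := LinearMap.exists_rightInverse_of_surjective (p.mkQ.restrictScalars k)
    (LinearMap.range_eq_top.2 hs)
  have hom : IsHom k H A.ρ (LinearMap.rTensor H (p.mkQ.restrictScalars k) ∘ₗ A.ρ ∘ₗ r)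
      (p.mkQ.restrictScalars k) := by
    refine ⟨fun h a => rfl, LinearMap.ext fun a => ?_⟩
    simp only [LinearMap.comp_apply]
    rw [← sub_eq_zero, ← map_sub, ← map_sub]
    have hm : r (p.mkQ.restrictScalars k a) - a ∈ p := by
      rw [← Submodule.Quotient.mk_eq_zero, Submodule.Quotient.mk_sub, sub_eq_zero]
      exact LinearMap.congr_fun hr (p.mkQ a)
    apply ctr_ext
    intro φ
    rw [ctr_rTensor]
    exact (Submodule.Quotient.mk_eq_zero p).2 ((isSubobject_iff _ _).1 hp _ hm φ)
  exact ⟨_, hom, comod_of_surj hom hs A.comod,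
    compat_of_surj hom hs ((compat_iff Sinv hS _).1 A.compat)⟩

/-- The bundled `Hom_H(X, B)`. -/
def homObj (hS : ∀ h, Sinv h = HopfAlgebra.antipode k h) (X B : YDCat k H Sinv)
    [Module.Finite H X.M] : YDCat k H Sinv where
  M := X.M →ₗ[H] B.M
  ρ := rhoQ ((compat_iff Sinv hS _).1 X.compat) ((compat_iff Sinv hS _).1 B.compat)
  comod := rhoQ_comod _ _ X.comod B.comod
  compat := (compat_iff Sinv hS _).2 (rhoQ_compat _ _)

lemma lift_hom (hS : ∀ h, Sinv h = HopfAlgebra.antipode k h)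
    (hdagger : DaggerYD k H Sinv) (hcoinv : CoinvExactYD k H Sinv)
    (X A B C : YDCat k H Sinv) [Module.Finite H X.M]
    (f : A.M →ₗ[k] B.M) (g : B.M →ₗ[k] C.M)
    (hf : IsHom k H A.ρ B.ρ f) (hg : IsHom k H B.ρ C.ρ g)
    (hi : Function.Injective f) (hs : Function.Surjective g)
    (he : LinearMap.range f = LinearMap.ker g)
    (t : X.M →ₗ[H] C.M) (ht : IsHom k H X.ρ C.ρ (t.restrictScalars k)) :
    ∃ s : X.M →ₗ[H] B.M, IsHom k H X.ρ B.ρ (s.restrictScalars k) ∧ ∀ x, g (s x) = t x := by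
  obtain ⟨d1, d2, d3⟩ := hdagger X inferInstance A B C f g hf hg hi hs he
  have cX := (compat_iff Sinv hS _).1 X.compat
  have cA := (compat_iff Sinv hS _).1 A.compat
  have cB := (compat_iff Sinv hS _).1 B.compat
  have cC := (compat_iff Sinv hS _).1 C.compat
  obtain ⟨-, -, e3⟩ := hcoinv (homObj hS X A) (homObj hS X B) (homObj hS X C)
    (postcompH (X := X.M) f hf.1) (postcompH (X := X.M) g hg.1)
    (rhoQ_nat cX cA cB hf) (rhoQ_nat cX cB cC hg) d1 d3 d2
  obtain ⟨s, hs'⟩ := e3 ⟨t, rhoQ_hom_coinv cX cC X.comod t ht⟩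
  refine ⟨s.1, rhoQ_coinv cX cB X.comod s.1 s.2, fun x => ?_⟩
  have := congrArg Subtype.val hs'
  exact LinearMap.congr_fun (show postcompH (X := X.M) g hg.1 s.1 = t from this) x

lemma range_isSubobject {X B : YDCat k H Sinv} (s : X.M →ₗ[H] B.M)
    (hs : IsHom k H X.ρ B.ρ (s.restrictScalars k)) : IsSubobject B.ρ (LinearMap.range s) := by
  rw [isSubobject_iff]
  rintro _ ⟨x, rfl⟩ φ
  have : B.ρ (s x) = LinearMap.rTensor H (s.restrictScalars k) (X.ρ x) :=
    LinearMap.congr_fun hs.2 x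
  rw [this, ctr_rTensor]
  exact ⟨_, rfl⟩

lemma exists_compl (hS : ∀ h, Sinv h = HopfAlgebra.antipode k h)
    (hdagger : DaggerYD k H Sinv) (hcoinv : CoinvExactYD k H Sinv) (A : YDCat k H Sinv)
    (N P : Submodule H A.M) (hN : IsSubobject A.ρ N) (hP : IsSubobject A.ρ P) (hPN : P ≤ N)
    (hfg : N.FG) : ∃ Q : Submodule H A.M, IsSubobject A.ρ Q ∧ P ⊓ Q = ⊥ ∧ P ⊔ Q = N := by
  obtain ⟨ρP, hP1, hP2, hP3⟩ := exists_sub hS A P hP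
  obtain ⟨ρC, hC1, hC2, hC3⟩ := exists_quot hS A P hP
  let PP : YDCat k H Sinv := ⟨P, ρP, hP2, (compat_iff Sinv hS _).2 hP3⟩
  let C : YDCat k H Sinv := ⟨A.M ⧸ P, ρC, hC2, (compat_iff Sinv hS _).2 hC3⟩
  have hX : IsSubobject C.ρ (N.map P.mkQ) := by
    rw [isSubobject_iff]
    rintro _ ⟨n, hn, rfl⟩ φ
    have : C.ρ (P.mkQ n) = LinearMap.rTensor H (P.mkQ.restrictScalars k) (A.ρ n) :=
      LinearMap.congr_fun hC1.2 n
    rw [this, ctr_rTensor]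
    exact ⟨_, (isSubobject_iff _ _).1 hN n hn φ, rfl⟩
  obtain ⟨ρX, hX1, hX2, hX3⟩ := exists_sub hS C (N.map P.mkQ) hX
  let X : YDCat k H Sinv := ⟨↥(N.map P.mkQ), ρX, hX2, (compat_iff Sinv hS _).2 hX3⟩
  have : Module.Finite H X.M := Module.Finite.iff_fg.2 (hfg.map P.mkQ)
  obtain ⟨s, hs, hsg⟩ := lift_hom hS hdagger hcoinv X PP A C (P.subtype.restrictScalars k)
    (P.mkQ.restrictScalars k) hP1 hC1 P.injective_subtype P.mkQ_surjective
    (by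
      ext a
      constructor
      · rintro ⟨b, rfl⟩
        exact (Submodule.Quotient.mk_eq_zero P).2 b.2
      · intro ha
        exact ⟨⟨a, (Submodule.Quotient.mk_eq_zero P).1 ha⟩, rfl⟩)
    (N.map P.mkQ).subtype hX1
  have hsg' : ∀ x : X.M, P.mkQ (s x) = x.1 := hsg
  refine ⟨LinearMap.range s, range_isSubobject s hs, ?_, ?_⟩
  · rw [eq_bot_iff]
    rintro _ ⟨h1, x, rfl⟩
    have h2 : P.mkQ (s x) = 0 := (Submodule.Quotient.mk_eq_zero P).2 h1
    rw [hsg'] at h2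
    have : x = 0 := Subtype.ext h2
    rw [this, map_zero]
    exact Submodule.zero_mem _
  · apply le_antisymm
    · refine sup_le hPN ?_
      rintro _ ⟨x, rfl⟩
      obtain ⟨n, hn, hx⟩ := x.2
      have h2 : s x - n ∈ P := by
        rw [← Submodule.Quotient.mk_eq_zero, Submodule.Quotient.mk_sub, sub_eq_zero]
        exact (hsg' x).trans hx.symm
      simpa using N.add_mem (hPN h2) hn
    · intro n hn
      have h2 : n - s ⟨P.mkQ n, n, hn, rfl⟩ ∈ P := by
        rw [← Submodule.Quotient.mk_eq_zero, Submodule.Quotient.mk_sub, sub_eq_zero]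
        exact (hsg' ⟨P.mkQ n, n, hn, rfl⟩).symm
      have := Submodule.add_mem_sup (T := LinearMap.range s) h2 ⟨⟨P.mkQ n, n, hn, rfl⟩, rfl⟩
      simpa using this

end Objs

section LocFin

variable {k H : Type} [Field k] [CommRing H] [HopfAlgebra k H]
variable {A : Type} [AddCommGroup A] [Module k A] [Module H A] [IsScalarTower k H A]
  [SMulCommClass H k A]
variable {ρ : A →ₗ[k] A ⊗[k] H}

lemma ctr_L_mem (N : Submodule H A) (y : A ⊗[k] H) (hy : ∀ φ : H →ₗ[k] k, ctr φ y ∈ N)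
    (w : H ⊗[k] H) (φ : H →ₗ[k] k) : ctr φ (L H A w y) ∈ N := by
  induction w using TensorProduct.induction_on with
  | zero => simp
  | add u v hu hv =>
    simp only [map_add, LinearMap.add_apply]
    exact N.add_mem hu hv
  | tmul a b =>
    have : ctr φ (L H A (a ⊗ₜ[k] b) y) = a • ctr (φ ∘ₗ LinearMap.mulLeft k b) y := by
      clear hy
      induction y using TensorProduct.induction_on with
      | zero => simp
      | add u v hu hv => simp only [map_add, smul_add, hu, hv]
      | tmul m t =>
        simp only [L_tmul, ctr_tmul, LinearMap.comp_apply, LinearMap.mulLeft_apply]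
        exact smul_comm _ _ _
    rw [this]
    exact N.smul_mem _ (hy _)

lemma ctr_ctr (hρ : IsComod k H ρ) (φ ψ : H →ₗ[k] k) (m : A) :
    ∃ χ : H →ₗ[k] k, ctr φ (ρ (ctr ψ (ρ m))) = ctr χ (ρ m) := by
  refine ⟨LinearMap.mul' k k ∘ₗ TensorProduct.map φ ψ ∘ₗ Coalgebra.comul, ?_⟩
  have h1 : ∀ z : (A ⊗[k] H) ⊗[k] H, ctr φ (ctr ψ z) =
      ctr (LinearMap.mul' k k ∘ₗ TensorProduct.map φ ψ) (TensorProduct.assoc k A H H z) := by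
    intro z
    obtain ⟨s, a, b, c, rfl⟩ := exists_nat_repr3 z
    simp [map_sum, smul_smul, mul_comm]
  have h2 : ∀ (χ : H ⊗[k] H →ₗ[k] k) (y : A ⊗[k] H),
      ctr χ (LinearMap.lTensor A (Coalgebra.comul (R := k) (A := H)) y) =
        ctr (χ ∘ₗ Coalgebra.comul) y := by
    intro χ y
    induction y using TensorProduct.induction_on with
    | zero => simp
    | add u v hu hv => simp only [map_add, hu, hv]
    | tmul m t => simp
  rw [← ctr_rTensor, h1, hρ.2, h2, LinearMap.comp_assoc]

lemma exists_fg (hρ : IsComod k H ρ) (hc : Compat' ρ) (m : A) :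
    ∃ N : Submodule H A, N.FG ∧ m ∈ N ∧ IsSubobject ρ N := by
  classical
  let b := Module.Basis.ofVectorSpace k H
  obtain ⟨I, hI⟩ := ctr_sum b (ρ m)
  let F : Finset A := I.image fun i => ctr (b.coord i) (ρ m)
  let N : Submodule H A := Submodule.span H (F : Set A)
  have hmem : ∀ φ : H →ₗ[k] k, ctr φ (ρ m) ∈ N := by
    intro φ
    rw [hI I subset_rfl, map_sum]
    refine Submodule.sum_mem _ fun i hi => ?_
    rw [ctr_tmul, ← algebraMap_smul H]
    exact N.smul_mem _ (Submodule.subset_span (Finset.mem_image_of_mem _ hi))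
  refine ⟨N, ⟨F, rfl⟩, ?_, ?_⟩
  · have := hmem Coalgebra.counit
    rwa [show ctr Coalgebra.counit (ρ m) = m from hρ.1 m] at this
  · rw [isSubobject_iff]
    intro n hn
    induction hn using Submodule.span_induction with
    | mem x hx =>
      intro φ
      obtain ⟨i, hi, rfl⟩ := Finset.mem_image.1 hx
      obtain ⟨χ, hχ⟩ := ctr_ctr hρ φ (b.coord i) m
      rw [hχ]
      exact hmem χ
    | zero => simp
    | add x y _ _ hx hy =>
      intro φ
      simp only [map_add]
      exact N.add_mem (hx φ) (hy φ)
    | smul h x _ hx =>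
      intro φ
      rw [hc]
      exact ctr_L_mem N _ hx _ φ

end LocFin

section Semi

variable {k H : Type} [Field k] [CommRing H] [HopfAlgebra k H]
variable {A : Type} [AddCommGroup A] [Module k A] [Module H A] [IsScalarTower k H A]
  [SMulCommClass H k A]

/-- The algebra of endomorphisms generated by the action and the dual action. -/
def RA (ρ : A →ₗ[k] A ⊗[k] H) : Subalgebra k (Module.End k A) :=
  Algebra.adjoin k (Set.range (fun h : H => (Algebra.lsmul k k A h : Module.End k A)) ∪
    Set.range (fun φ : H →ₗ[k] k => (ctr φ ∘ₗ ρ : Module.End k A)))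

instance RA_smul (ρ : A →ₗ[k] A ⊗[k] H) : SMul H (RA ρ) where
  smul h r := ⟨Algebra.lsmul k k A h,
    Algebra.subset_adjoin (Set.mem_union_left _ ⟨h, rfl⟩)⟩ * r

instance RA_tower (ρ : A →ₗ[k] A ⊗[k] H) : IsScalarTower H (RA ρ) A where
  smul_assoc _ _ _ := rfl

lemma restrict_isSubobject (ρ : A →ₗ[k] A ⊗[k] H) (N : Submodule (RA ρ) A) :
    IsSubobject ρ (N.restrictScalars H) := by
  rw [isSubobject_iff]
  intro m hm φ
  exact N.smul_mem (⟨ctr φ ∘ₗ ρ, Algebra.subset_adjoin (Set.mem_union_right _ ⟨φ, rfl⟩)⟩ : RA ρ) hm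

lemma exists_restrict (ρ : A →ₗ[k] A ⊗[k] H) (N : Submodule H A) (hN : IsSubobject ρ N) :
    ∃ N' : Submodule (RA ρ) A, N'.restrictScalars H = N := by
  rw [isSubobject_iff] at hN
  have key : ∀ r ∈ RA ρ, ∀ x ∈ N, r x ∈ N := by
    intro r hr
    induction hr using Algebra.adjoin_induction with
    | mem x hx =>
      rcases hx with ⟨h, rfl⟩ | ⟨φ, rfl⟩
      · exact fun x hx => N.smul_mem h hx
      · exact fun x hx => hN x hx φ
    | algebraMap c =>
      intro x hx
      change c • x ∈ N
      rw [← algebraMap_smul H]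
      exact N.smul_mem _ hx
    | add x y _ _ hx hy => exact fun a ha => N.add_mem (hx a ha) (hy a ha)
    | mul x y _ _ hx hy => exact fun a ha => hx _ (hy a ha)
  exact ⟨{ N.toAddSubmonoid with smul_mem' := fun r x hx => key r.1 r.2 x hx }, rfl⟩

lemma isSemisimpleObj_of [IsNoetherianRing H] (ρ : A →ₗ[k] A ⊗[k] H)
    (hfin : ∀ m : A, ∃ N : Submodule H A, N.FG ∧ m ∈ N ∧ IsSubobject ρ N)
    (hcompl : ∀ N P : Submodule H A, IsSubobject ρ N → IsSubobject ρ P → P ≤ N → N.FG →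
      ∃ Q : Submodule H A, IsSubobject ρ Q ∧ P ⊓ Q = ⊥ ∧ P ⊔ Q = N) :
    IsSemisimpleObj ρ := by
  have hinj : Function.Injective
      (fun N : Submodule (RA ρ) A => N.restrictScalars H) :=
    Submodule.restrictScalars_injective H (RA ρ) A
  have hfin' : ∀ m : A, ∃ N : Submodule (RA ρ) A, (N.restrictScalars H).FG ∧ m ∈ N := by
    intro m
    obtain ⟨N, h1, h2, h3⟩ := hfin m
    obtain ⟨N, rfl⟩ := exists_restrict ρ N h3
    exact ⟨N, h1, h2⟩
  choose F hF1 hF2 using hfin'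
  have hss : ∀ m, IsSemisimpleModule (RA ρ) (F m) := by
    intro m
    rw [isSemisimpleModule_iff, (F m).mapIic.complementedLattice_iff]
    constructor
    rintro ⟨P, hP⟩
    obtain ⟨Q, h1, h2, h3⟩ := hcompl ((F m).restrictScalars H) (P.restrictScalars H)
      (restrict_isSubobject ρ _) (restrict_isSubobject ρ _) hP (hF1 m)
    obtain ⟨Q, rfl⟩ := exists_restrict ρ Q h1
    have h2' : P ⊓ Q = ⊥ := hinj (by simpa using h2)
    have h3' : P ⊔ Q = F m := hinj (by
      exact (map_sup (Submodule.restrictScalarsLatticeHom H (RA ρ) A) P Q).trans h3)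
    have hQ : Q ≤ F m := h3' ▸ le_sup_right
    refine ⟨⟨Q, hQ⟩, ?_, ?_⟩
    · rw [disjoint_iff]
      exact Subtype.ext h2'
    · rw [codisjoint_iff]
      exact Subtype.ext h3'
  have htop : (⨆ m, F m) = ⊤ := by
    rw [eq_top_iff]
    intro m _
    exact Submodule.mem_iSup_of_mem m (hF2 m)
  have hM : IsSemisimpleModule (RA ρ) A :=
    isSemisimpleModule_of_isSemisimpleModule_submodule' hss htop
  obtain ⟨s, hs1, hs2, hs3⟩ := IsSemisimpleModule.exists_sSupIndep_sSup_simples_eq_top (RA ρ) A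
  refine ⟨s, fun i => i.1.restrictScalars H, fun i => ?_, ?_, ?_⟩
  · have hat : IsAtom i.1 := isSimpleModule_iff_isAtom.1 (hs3 i.1 i.2)
    refine ⟨⟨restrict_isSubobject ρ _, ?_, ?_⟩, ?_⟩
    · intro h
      exact hat.1 (hinj (by simpa using h))
    · intro q hq hle
      obtain ⟨q, rfl⟩ := exists_restrict ρ q hq
      rcases hat.le_iff.1 (show q ≤ i.1 from hle) with h | h
      · left; rw [h]; simp
      · right; rw [h]
    · obtain ⟨m, hm, hm0⟩ := Submodule.exists_mem_ne_zero_of_ne_bot hat.1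
      have hle : i.1 ≤ F m := by
        rcases hat.le_iff.1 (inf_le_left : i.1 ⊓ F m ≤ i.1) with h | h
        · have hmm : m ∈ i.1 ⊓ F m := ⟨hm, hF2 m⟩
          rw [h] at hmm
          exact absurd ((Submodule.mem_bot _).1 hmm) hm0
        · exact inf_eq_left.1 h
      have hno : IsNoetherian H ((F m).restrictScalars H) :=
        isNoetherian_of_fg_of_noetherian _ (hF1 m)
      exact isNoetherian_submodule.1 hno _ hle
  · have := (sSupIndep_iff s).1 hs1
    intro i
    have h := this i
    rw [disjoint_iff] at h ⊢
    have h' := congrArg (Submodule.restrictScalarsLatticeHom H (RA ρ) A) h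
    rw [map_inf, map_iSup] at h'
    simp_rw [map_iSup] at h'
    rw [map_bot] at h'
    exact h'
  · rw [sSup_eq_iSup'] at hs2
    have h' := congrArg (Submodule.restrictScalarsLatticeHom H (RA ρ) A) hs2
    rw [map_iSup, map_top] at h'
    exact h'

end Semi

/-- Corollary 3.3. Let `k` be a field and `H` a commutative
noetherian Hopf algebra over `k` with bijective antipode. If the category of
Yetter-Drinfeld modules satisfies condition (†) and the coinvariants functor is
exact on Yetter-Drinfeld modules, then every Yetter-Drinfeld module is a direct sum
of a family of simple subobjects that are finitely generated as `H`-modules; in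
particular the category of Yetter-Drinfeld modules is semisimple. -/
theorem YetterDrinfeld_semisimple_of_dagger_and_coinvariants_exact
    (k H : Type) [Field k] [CommRing H] [HopfAlgebra k H]
    (Sinv : H →ₗ[k] H)
    (hS1 : ∀ h : H, Sinv (HopfAlgebra.antipode (R := k) (A := H) h) = h)
    (hS2 : ∀ h : H, HopfAlgebra.antipode (R := k) (A := H) (Sinv h) = h)
    (hnoeth : IsNoetherianRing H)
    (hdagger : DaggerYD k H Sinv)
    (hcoinv : CoinvExactYD k H Sinv) :
    ∀ A : YDCat k H Sinv, IsSemisimpleObj A.ρ := by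
  intro A
  have hS : ∀ h, Sinv h = HopfAlgebra.antipode k h := by
    intro h
    have := hS1 (HopfAlgebra.antipode k h)
    rwa [antipode_sq] at this
  exact isSemisimpleObj_of A.ρ
    (exists_fg A.comod ((compat_iff Sinv hS _).1 A.compat))
    (fun N P hN hP hPN hfg => exists_compl hS hdagger hcoinv A N P hN hP hPN hfg)
end YDPaper
end
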